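/- arXiv:1804.07929 — 3 statements merged into one kernel-verified Lean document; each statement's English description precedes it below -/
import Mathlib

section
/- Let p be a prime with p ≡ 1 (mod 4), and write p = a^2 + b^2 with a, b integers and a ≡ 1 (mod 4). Then the binomial coefficient C((p-1)/2, (p-1)/4) ≡ 2a (mod p). -/
open Finset

section FiniteField

variable {F : Type*} [Field F] [Fintype F]

lemma even_sum_of_neg_invariant (hF : ringChar F ≠ 2) {f : F → ℤ} (h0 : f 0 = 0)
    (hf : ∀ x, f (-x) = f x) : Even (∑ x, f x) := by
  rw [← ZMod.intCast_eq_zero_iff_even, Int.cast_sum]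
  refine sum_involution (fun x _ ↦ -x) (fun x _ ↦ ?_) (fun x _ hx h ↦ hx ?_)
    (fun _ _ ↦ mem_univ _) (fun x _ ↦ neg_neg x)
  · rw [hf, CharTwo.add_self_eq_zero]
  · rw [Ring.eq_self_iff_eq_zero_of_char_ne_two hF |>.mp h, h0, Int.cast_zero]

variable [DecidableEq F]

/-- The Jacobsthal sum `∑ x, χ (x (x² + k))`, where `χ` is the quadratic character of `F`. -/
def jacobsthalSum (k : F) : ℤ :=
  ∑ x : F, quadraticChar F x * quadraticChar F (x ^ 2 + k)

lemma sum_comp_sq (hF : ringChar F ≠ 2) (f : F → ℤ) :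
    ∑ x : F, f (x ^ 2) = ∑ u : F, (quadraticChar F u + 1) * f u := by
  rw [← sum_fiberwise univ (fun x : F ↦ x ^ 2) fun x ↦ f (x ^ 2)]
  refine sum_congr rfl fun u _ ↦ ?_
  rw [sum_congr rfl (g := fun _ ↦ f u) (by simp +contextual), sum_const, nsmul_eq_mul,
    ← quadraticChar_card_sqrts hF u]
  congr 3
  ext x
  simp

lemma quadraticChar_mul_self_of_ne_zero {a : F} (ha : a ≠ 0) :
    quadraticChar F a * quadraticChar F a = 1 := by
  rw [← sq, quadraticChar_sq_one ha]

lemma sum_quadraticChar_mul_quadraticChar_add (hF : ringChar F ≠ 2) {c : F} (hc : c ≠ 0) :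
    ∑ x : F, quadraticChar F x * quadraticChar F (x + c) = -1 := by
  have hJ := jacobiSum_nontrivial_inv (quadraticChar_ne_one hF)
  rw [quadraticChar_isQuadratic F |>.inv, jacobiSum] at hJ
  rw [← (Equiv.mulLeft₀ (-c) (neg_ne_zero.mpr hc)).sum_comp _ _ (by simp)]
  have h (x : F) : quadraticChar F (-c * x) * quadraticChar F (-c * x + c) =
      quadraticChar F (-1) * (quadraticChar F x * quadraticChar F (1 - x)) := by
    rw [show -c * x = -1 * c * x by ring, show -1 * c * x + c = c * (1 - x) by ring]
    simp only [map_mul]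
    linear_combination (quadraticChar F (-1) * quadraticChar F x * quadraticChar F (1 - x)) *
      quadraticChar_mul_self_of_ne_zero hc
  simp only [Equiv.mulLeft₀_apply, h]
  rw [← mul_sum, hJ, mul_neg, quadraticChar_mul_self_of_ne_zero (neg_ne_zero.mpr one_ne_zero)]

lemma sum_quadraticChar_add_mul_quadraticChar_add (hF : ringChar F ≠ 2) (c d : F) :
    ∑ k : F, quadraticChar F (c + k) * quadraticChar F (d + k) =
      (if c = d then (Fintype.card F : ℤ) else 0) - 1 := by
  rw [← (Equiv.subRight c).sum_comp]
  simp only [Equiv.subRight_apply, add_sub_cancel]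
  split_ifs with h
  · subst h
    have h (x : F) : quadraticChar F x * quadraticChar F (c + (x - c)) =
        1 - if x = 0 then 1 else 0 := by
      rw [add_sub_cancel]
      split_ifs with hx
      · simp [hx]
      · rw [quadraticChar_mul_self_of_ne_zero hx, sub_zero]
    simp only [h, sum_sub_distrib]
    simp
  · rw [zero_sub, ← sum_quadraticChar_mul_quadraticChar_add hF (sub_ne_zero.mpr (Ne.symm h))]
    exact sum_congr rfl fun x _ ↦ by rw [show d + (x - c) = x + (d - c) by ring]

lemma jacobsthalSum_zero (hF : ringChar F ≠ 2) : jacobsthalSum (0 : F) = 0 := by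
  rw [jacobsthalSum, ← quadraticChar_sum_zero hF]
  refine sum_congr rfl fun x _ ↦ ?_
  rcases eq_or_ne x 0 with rfl | hx
  · simp
  · rw [add_zero, quadraticChar_sq_one' hx, mul_one]

lemma jacobsthalSum_mul_sq (k : F) {t : F} (ht : t ≠ 0) :
    jacobsthalSum (k * t ^ 2) = quadraticChar F t * jacobsthalSum k := by
  rw [jacobsthalSum, jacobsthalSum, mul_sum, ← (Equiv.mulLeft₀ t ht).sum_comp _ _ (by simp)]
  refine sum_congr rfl fun x _ ↦ ?_
  rw [Equiv.mulLeft₀_apply, show (t * x) ^ 2 + k * t ^ 2 = t ^ 2 * (x ^ 2 + k) by ring,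
    map_mul, map_mul, quadraticChar_sq_one' ht, one_mul, mul_assoc]

lemma jacobsthalSum_mul_sq_sq (k : F) {t : F} (ht : t ≠ 0) :
    jacobsthalSum (k * t ^ 2) ^ 2 = jacobsthalSum k ^ 2 := by
  rw [jacobsthalSum_mul_sq k ht, mul_pow, quadraticChar_sq_one ht, one_mul]

lemma sum_jacobsthalSum_sq (hF : ringChar F ≠ 2) (h1 : quadraticChar F (-1) = 1) :
    ∑ k : F, jacobsthalSum k ^ 2 = 2 * Fintype.card F * (Fintype.card F - 1) := by
  have hne (y : F) (hy : y ≠ 0) : y ≠ -y :=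
    fun h ↦ hy (Ring.eq_self_iff_eq_zero_of_char_ne_two hF |>.mp h.symm)
  have expand (k : F) : jacobsthalSum k ^ 2 = ∑ x : F, ∑ y : F,
      quadraticChar F x * quadraticChar F y *
        (quadraticChar F (x ^ 2 + k) * quadraticChar F (y ^ 2 + k)) := by
    rw [sq, jacobsthalSum, sum_mul_sum]
    exact sum_congr rfl fun x _ ↦ sum_congr rfl fun y _ ↦ by ring
  have inner (x : F) : ∑ y : F, quadraticChar F x * quadraticChar F y *
      ((if x ^ 2 = y ^ 2 then (Fintype.card F : ℤ) else 0) - 1) =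
      2 * Fintype.card F * (1 - if x = 0 then 1 else 0) := by
    rcases eq_or_ne x 0 with rfl | hx
    · simp
    have h (y : F) : quadraticChar F x * quadraticChar F y *
        ((if x ^ 2 = y ^ 2 then (Fintype.card F : ℤ) else 0) - 1) =
        (if y = x then (Fintype.card F : ℤ) else 0) +
          (if y = -x then (Fintype.card F : ℤ) else 0) -
          quadraticChar F x * quadraticChar F y := by
      by_cases h₁ : y = x
      · subst h₁
        simp only [quadraticChar_mul_self_of_ne_zero hx]
        simp [hne y hx]
      by_cases h₂ : y = -x
      · subst h₂
        have : quadraticChar F (-x) = quadraticChar F x := by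
          rw [← neg_one_mul, map_mul, h1, one_mul]
        simp only [this, quadraticChar_mul_self_of_ne_zero hx]
        simp [h₁]
      · have : x ^ 2 ≠ y ^ 2 := fun h ↦ (sq_eq_sq_iff_eq_or_eq_neg.mp h.symm).elim h₁ h₂
        simp [h₁, h₂, this]
    simp only [h, sum_sub_distrib, sum_add_distrib, ← mul_sum, quadraticChar_sum_zero hF]
    simp [hx]
    ring
  simp only [expand]
  rw [sum_comm]
  simp_rw [sum_comm (f := fun k y ↦ _ * (quadraticChar F (_ + k) * _))]
  simp only [← mul_sum, sum_quadraticChar_add_mul_quadraticChar_add hF, inner]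
  simp

lemma jacobsthalSum_one_sq_add_sq (hF : ringChar F ≠ 2) (h1 : quadraticChar F (-1) = 1)
    {g : F} (hg : quadraticChar F g = -1) :
    jacobsthalSum (1 : F) ^ 2 + jacobsthalSum g ^ 2 = 4 * Fintype.card F := by
  have key (k : F) : 2 * jacobsthalSum k ^ 2 =
      (1 + quadraticChar F k) * jacobsthalSum (1 : F) ^ 2 +
      (1 - quadraticChar F k) * jacobsthalSum g ^ 2 -
      if k = 0 then jacobsthalSum (1 : F) ^ 2 + jacobsthalSum g ^ 2 else 0 := by
    have hg0 : g ≠ 0 := by rintro rfl; simp at hg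
    rcases eq_or_ne k 0 with rfl | hk
    · simp [jacobsthalSum_zero hF]
    rcases quadraticChar_dichotomy hk with h | h
    · obtain ⟨t, rfl⟩ := (quadraticChar_one_iff_isSquare hk).mp h
      have ht : t ≠ 0 := by rintro rfl; simp at hk
      have := jacobsthalSum_mul_sq_sq 1 ht
      rw [one_mul, sq t] at this
      rw [h, this]
      simp [ht]
    · have hkg : quadraticChar F (k / g) = 1 := by
        have := congrArg (quadraticChar F) (div_mul_cancel₀ k hg0)
        rw [map_mul, hg, h] at this
        linarith
      obtain ⟨t, ht'⟩ := (quadraticChar_one_iff_isSquare (div_ne_zero hk hg0)).mp hkg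
      have ht : t ≠ 0 := by rintro rfl; simp [hk, hg0] at ht'
      have := jacobsthalSum_mul_sq_sq g ht
      rw [sq t, ← ht', mul_div_cancel₀ _ hg0] at this
      rw [h, this]
      simp [hk]
  have hsum := sum_congr (rfl : (univ : Finset F) = univ) fun k _ ↦ key k
  rw [← mul_sum, sum_jacobsthalSum_sq hF h1, sum_sub_distrib, sum_add_distrib, ← sum_mul,
    ← sum_mul, sum_add_distrib, sum_sub_distrib, quadraticChar_sum_zero hF] at hsum
  simp at hsum
  have hcard : (1 : ℤ) < Fintype.card F := mod_cast Fintype.one_lt_card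
  have hne : (Fintype.card F : ℤ) - 1 ≠ 0 := by linarith
  apply mul_left_cancel₀ hne
  linear_combination -hsum

lemma sum_quadraticChar_sq_add_one (hF : ringChar F ≠ 2) :
    ∑ x : F, quadraticChar F (x ^ 2 + 1) = -1 := by
  rw [sum_comp_sq hF fun u ↦ quadraticChar F (u + 1)]
  simp only [add_mul, one_mul, sum_add_distrib]
  rw [sum_quadraticChar_mul_quadraticChar_add hF one_ne_zero,
    Fintype.sum_equiv (Equiv.addRight (1 : F)) (fun u ↦ quadraticChar F (u + 1)) (quadraticChar F)
      fun _ ↦ rfl, quadraticChar_sum_zero hF, add_zero]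

lemma quadraticChar_eq_of_sq_eq_neg_one (hF : ringChar F ≠ 2) (h4 : Fintype.card F % 4 = 1)
    {x : F} (hx : x ^ 2 = -1) :
    quadraticChar F x = if Fintype.card F % 8 = 1 then 1 else -1 := by
  have hx0 : x ≠ 0 := by rintro rfl; simp at hx
  have h2 : Fintype.card F / 2 = 2 * (Fintype.card F / 4) := by lia
  rw [quadraticChar_eq_pow_of_char_ne_two hF hx0, h2, pow_mul, hx]
  split_ifs with h h8 h8
  · rfl
  · rw [Odd.neg_one_pow (Nat.odd_iff.mpr (by lia))] at h
    exact (Ring.neg_one_ne_one_of_char_ne_two hF h).elim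
  · exact (h (Even.neg_one_pow (Nat.even_iff.mpr (by lia)))).elim
  · rfl

lemma quadraticChar_neg_one_of_card_mod_four (h4 : Fintype.card F % 4 = 1) :
    quadraticChar F (-1) = 1 :=
  (quadraticChar_one_iff_isSquare (neg_ne_zero.mpr one_ne_zero)).mpr
    (FiniteField.isSquare_neg_one_iff.mpr (by lia))

lemma jacobsthalSum_one_modEq (hF : ringChar F ≠ 2) (h4 : Fintype.card F % 4 = 1) :
    jacobsthalSum (1 : F) ≡ -2 [ZMOD 8] := by
  have h1 := quadraticChar_neg_one_of_card_mod_four h4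
  let h (x : F) : ℤ := (quadraticChar F x - 1) *
    (quadraticChar F (x ^ 2 + 1) - 1 + if x ^ 2 = -1 then 1 else 0)
  have h_zero : h 0 = 0 := by simp [h]
  have h_neg (x : F) : h (-x) = h x := by
    simp only [h, neg_sq]
    rw [← neg_one_mul, map_mul, h1, one_mul]
  have h_dvd (x : F) : 4 ∣ h x := by
    rcases eq_or_ne x 0 with rfl | hx
    · rw [h_zero]
      exact dvd_zero 4
    rw [show (4 : ℤ) = 2 * 2 by rfl]
    refine mul_dvd_mul ?_ ?_
    · rcases quadraticChar_dichotomy hx with h | h <;> rw [h] <;> decide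
    · split_ifs with hx1
      · simp [hx1]
      · have hx2 : x ^ 2 + 1 ≠ 0 := fun h ↦ hx1 (eq_neg_of_add_eq_zero_left h)
        rcases quadraticChar_dichotomy hx2 with h | h <;> rw [h] <;> decide
  obtain ⟨m, hm⟩ := even_sum_of_neg_invariant hF (f := fun x ↦ h x / 4) (by simp [h_zero])
    fun x ↦ by rw [h_neg]
  have hsum : ∑ x, h x = 8 * m := by
    rw [← sum_congr rfl fun x _ ↦ Int.mul_ediv_cancel' (h_dvd x), ← mul_sum, hm]
    ring
  set c : ℤ := if Fintype.card F % 8 = 1 then 1 else -1 with hc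
  have hterm (x : F) : h x = quadraticChar F x * quadraticChar F (x ^ 2 + 1) - quadraticChar F x -
      quadraticChar F (x ^ 2 + 1) + 1 + if x ^ 2 = -1 then c - 1 else 0 := by
    simp only [h]
    split_ifs with hx
    · rw [quadraticChar_eq_of_sq_eq_neg_one hF h4 hx, ← hc]
      ring
    · ring
  have hroots : ∑ x : F, (if x ^ 2 = -1 then c - 1 else 0) = 2 * (c - 1) := by
    rw [sum_comp_sq hF fun u ↦ if u = -1 then c - 1 else 0]
    simp only [mul_ite, mul_zero, sum_ite_eq', mem_univ, if_true, h1]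
    ring
  simp only [hterm, sum_add_distrib, sum_sub_distrib, quadraticChar_sum_zero hF,
    sum_quadraticChar_sq_add_one hF, hroots] at hsum
  rw [← jacobsthalSum] at hsum
  simp only [sum_const, card_univ, nsmul_eq_mul, mul_one] at hsum
  rw [Int.modEq_iff_dvd]
  split_ifs at hc <;> lia

lemma FiniteField.sum_pow_of_ne_zero {i : ℕ} (hi : i ≠ 0) :
    ∑ x : F, x ^ i = if Fintype.card F - 1 ∣ i then -1 else 0 := by
  rw [← FiniteField.sum_pow_units F i, ← Fintype.sum_subtype_add_sum_subtype (· ≠ (0 : F))]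
  rw [sum_eq_zero (s := (univ : Finset {x : F // ¬ x ≠ 0})), add_zero]
  · exact (Fintype.sum_equiv unitsEquivNeZero _ _ fun _ ↦ rfl).symm
  · rintro ⟨x, hx⟩ -
    simp [not_not.mp hx, hi]

lemma jacobsthalSum_one_cast (hF : ringChar F ≠ 2) (h4 : Fintype.card F % 4 = 1) :
    (jacobsthalSum (1 : F) : F) =
      -(((Fintype.card F - 1) / 2).choose ((Fintype.card F - 1) / 4) : F) := by
  obtain ⟨n, hn⟩ : ∃ n, Fintype.card F = 4 * n + 1 := ⟨Fintype.card F / 4, by lia⟩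
  have hcard : 1 < Fintype.card F := Fintype.one_lt_card
  rw [show (Fintype.card F - 1) / 2 = 2 * n by lia, show (Fintype.card F - 1) / 4 = n by lia]
  simp only [jacobsthalSum, Int.cast_sum, Int.cast_mul, quadraticChar_eq_pow_of_char_ne_two' hF]
  rw [show Fintype.card F / 2 = 2 * n by lia]
  simp only [add_pow, one_pow, mul_one, mul_sum]
  rw [sum_comm, sum_eq_single_of_mem n (mem_range.mpr (by lia))]
  · simp only [← mul_assoc, ← sum_mul, ← pow_mul, ← pow_add]
    rw [FiniteField.sum_pow_of_ne_zero (by lia), if_pos ⟨1, by lia⟩, neg_one_mul]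
  · intro j hj hjn
    simp only [← mul_assoc, ← sum_mul, ← pow_mul, ← pow_add]
    rw [FiniteField.sum_pow_of_ne_zero (by lia), if_neg, zero_mul]
    rintro ⟨k, hk⟩
    rw [hn, Nat.add_sub_cancel] at hk
    have := mem_range.mp hj
    have hk' : k < 2 := by
      by_contra! h
      nlinarith
    interval_cases k <;> lia

end FiniteField

lemma sq_eq_sq_of_prime_eq_sq_add_sq {p : ℕ} (hp : p.Prime) {a b c d : ℤ}
    (hab : (p : ℤ) = a ^ 2 + b ^ 2) (hcd : (p : ℤ) = c ^ 2 + d ^ 2) (ha : Odd a) (hc : Odd c)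
    (hodd : Odd p) : a ^ 2 = c ^ 2 := by
  have hp0 : (p : ℤ) ≠ 0 := mod_cast hp.ne_zero
  have main (d : ℤ) (hcd : (p : ℤ) = c ^ 2 + d ^ 2) (hdvd : (p : ℤ) ∣ a * d - b * c) :
      a ^ 2 = c ^ 2 := by
    have hsq : (a * c + b * d) ^ 2 + (a * d - b * c) ^ 2 = (p : ℤ) ^ 2 := by
      rw [sq (p : ℤ)]
      nth_rw 1 [hab]
      rw [hcd]
      ring
    obtain ⟨k, hk⟩ := hdvd
    rcases eq_or_ne k 0 with rfl | hk0
    · apply mul_left_cancel₀ hp0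
      linear_combination a ^ 2 * hcd - c ^ 2 * hab + (a * d + b * c) * hk
    · have hk1 : 0 < k ^ 2 := by positivity
      have hzero : a * c + b * d = 0 := by
        rw [hk] at hsq
        have := sq_nonneg (p : ℤ)
        exact pow_eq_zero_iff two_ne_zero |>.mp (le_antisymm (by nlinarith) (sq_nonneg _))
      have hpac : (p : ℤ) = a ^ 2 + c ^ 2 := by
        apply mul_left_cancel₀ hp0
        linear_combination (b * d - a * c) * hzero + (p - c ^ 2) * hab + b ^ 2 * hcd
      have hev : Even (p : ℤ) := hpac ▸ ha.pow.add_odd hc.pow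
      exact (Int.not_even_iff_odd.mpr ((Int.odd_coe_nat p).mpr hodd) hev).elim
  have hmul : (p : ℤ) ∣ (a * d - b * c) * (a * d - b * -c) :=
    ⟨a ^ 2 - c ^ 2, by linear_combination c ^ 2 * hab - a ^ 2 * hcd⟩
  rcases (Nat.prime_iff_prime_int.mp hp).dvd_mul.mp hmul with h | h
  · exact main d hcd h
  · exact main (-d) (by rw [hcd, neg_sq]) (by rw [← dvd_neg]; convert h using 1; ring)

/-- Gauss (1828): for a prime `p ≡ 1 (mod 4)` with `p = a² + b²`, `a ≡ 1 (mod 4)`,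
`C((p-1)/2, (p-1)/4) ≡ 2a (mod p)`. -/
theorem gauss_congruence (p : ℕ) (hp : p.Prime) (hp4 : p % 4 = 1)
    (a b : ℤ) (hab : (p : ℤ) = a ^ 2 + b ^ 2) (ha : a ≡ 1 [ZMOD 4]) :
    ((Nat.choose ((p - 1) / 2) ((p - 1) / 4) : ℤ)) ≡ 2 * a [ZMOD p] := by
  have : Fact p.Prime := ⟨hp⟩
  have hF : ringChar (ZMod p) ≠ 2 := by
    rw [ZMod.ringChar_zmod_n]
    lia
  have hcard : Fintype.card (ZMod p) = p := ZMod.card p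
  have h4 : Fintype.card (ZMod p) % 4 = 1 := by rw [hcard, hp4]
  obtain ⟨g, hg⟩ := quadraticChar_exists_neg_one hF
  have hsq := jacobsthalSum_one_sq_add_sq hF (quadraticChar_neg_one_of_card_mod_four h4) hg
  obtain ⟨m, hm⟩ := Int.modEq_iff_dvd.mp (jacobsthalSum_one_modEq hF h4)
  have hcast := jacobsthalSum_one_cast hF h4
  rw [hcard] at hcast hsq
  generalize jacobsthalSum (1 : ZMod p) = s at *
  generalize jacobsthalSum g = t at *
  obtain rfl : s = -2 * (4 * m + 1) := by linarith
  obtain ⟨d, rfl⟩ : Even t := by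
    rw [← Int.even_pow' two_ne_zero, show t ^ 2 = 2 * (2 * p - 2 * (4 * m + 1) ^ 2) by linarith]
    exact even_two_mul _
  have ha4 : a % 4 = 1 := ha
  have haA : a ^ 2 = (4 * m + 1) ^ 2 :=
    sq_eq_sq_of_prime_eq_sq_add_sq hp hab (d := d) (by linarith)
      (Int.odd_iff.mpr (by lia)) (Int.odd_iff.mpr (by lia)) (Nat.odd_iff.mpr (by lia))
  obtain rfl : a = 4 * m + 1 := (sq_eq_sq_iff_eq_or_eq_neg.mp haA).resolve_right (by lia)
  rw [← ZMod.intCast_eq_intCast_iff]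
  push_cast at hcast ⊢
  linear_combination hcast
end

section
/- Let p be a prime with p ≡ 1 (mod 4), write p = a^2 + b^2 with a ≡ 1 (mod 4), and let q_p(2) = (2^{p-1} - 1)/p be the Fermat quotient. Then C((p-1)/2, (p-1)/4) ≡ (1 + (1/2)·p·q_p(2))·(2a - p/(2a)) (mod p^2), as a congruence of p-adic integers. -/
open Finset

/-- The Teichmüller character of `ZMod p` with values in `ℤ_[p]`. -/
noncomputable def teichmullerChar (p : ℕ) [Fact p.Prime] : MulChar (ZMod p) ℤ_[p] where
  toMonoidHom := ((WittVector.equiv p : WittVector p (ZMod p) →* ℤ_[p])).comp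
    (WittVector.teichmuller p)
  map_nonunit' x hx := by
    have h : x = 0 := by simpa [isUnit_iff_ne_zero] using hx
    simp [h]

theorem toZMod_teichmullerChar (p : ℕ) [Fact p.Prime] (x : ZMod p) :
    PadicInt.toZMod (teichmullerChar p x) = x := by
  have key : ∀ (f : ℤ_[p] →+* ZMod p) (z : ℤ_[p]), f z = PadicInt.toZMod z := by
    intro f z
    have hz := PadicInt.toZMod_spec z
    rw [PadicInt.maximalIdeal_eq_span_p, Ideal.mem_span_singleton] at hz
    obtain ⟨w, hw⟩ := hz
    rw [sub_eq_iff_eq_add.mp hw]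
    have hc : ∀ (g : ℤ_[p] →+* ZMod p) (y : ZMod p), g (ZMod.cast y : ℤ_[p]) = y := by
      intro g y
      rw [ZMod.cast_eq_val, map_natCast, ZMod.natCast_zmod_val]
    simp [hc]
  rw [← key ((WittVector.constantCoeff : WittVector p (ZMod p) →+* ZMod p).comp
    (WittVector.equiv p).symm.toRingHom)]
  simp [teichmullerChar, WittVector.constantCoeff]

theorem teichmullerChar_pow_card_sub_one (p : ℕ) [Fact p.Prime] {x : ZMod p} (hx : x ≠ 0) :
    teichmullerChar p x ^ (p - 1) = 1 := by
  rw [← map_pow, ZMod.pow_card_sub_one_eq_one hx, map_one]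

theorem teichmullerChar_pow_ne_one (p : ℕ) [Fact p.Prime] {e : ℕ} (h : ¬ (p - 1) ∣ e) :
    teichmullerChar p ^ e ≠ 1 := by
  intro hc
  apply h
  have := (FiniteField.forall_pow_eq_one_iff (ZMod p) e).mp ?_
  · rwa [ZMod.card] at this
  intro x
  have h1 := congrArg (fun χ : MulChar (ZMod p) ℤ_[p] => χ (x : ZMod p)) hc
  simp only [MulChar.pow_apply_coe, MulChar.one_apply_coe] at h1
  have h2 := congrArg PadicInt.toZMod h1
  rw [map_pow, toZMod_teichmullerChar, map_one] at h2
  exact Units.ext (by simpa using h2)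

theorem sum_teichmullerChar_pow (p : ℕ) [Fact p.Prime] {e : ℕ} (he : e ≠ 0) :
    ∑ x : ZMod p, teichmullerChar p x ^ e = if (p - 1) ∣ e then (p : ℤ_[p]) - 1 else 0 := by
  split_ifs with h
  · obtain ⟨k, rfl⟩ := h
    have h1 : ∀ x ∈ univ.erase (0 : ZMod p), teichmullerChar p x ^ ((p - 1) * k) = 1 := by
      intro x hx
      rw [pow_mul, teichmullerChar_pow_card_sub_one p (Finset.ne_of_mem_erase hx), one_pow]
    rw [← Finset.add_sum_erase _ _ (mem_univ (0 : ZMod p)), Finset.sum_congr rfl h1]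
    have hp1 : 1 ≤ p := (Fact.out : p.Prime).one_le
    simp [MulChar.map_zero, zero_pow he, ZMod.card, Nat.cast_sub hp1]
  · rw [← MulChar.sum_eq_zero_of_ne_one (teichmullerChar_pow_ne_one p h)]
    simp [MulChar.pow_apply' _ he]

theorem ZMod.sum_pow_eq_ite (p : ℕ) [Fact p.Prime] {e : ℕ} (he : e ≠ 0) :
    ∑ x : ZMod p, x ^ e = if (p - 1) ∣ e then -1 else 0 := by
  have h := congrArg PadicInt.toZMod (sum_teichmullerChar_pow p he)
  rw [map_sum] at h
  simp only [map_pow, toZMod_teichmullerChar] at h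
  rw [h]
  split_ifs <;> simp

theorem sum_range_alternating_sub_mul_choose (n J : ℕ) :
    ∑ j ∈ range (J + 2), (-1 : ℤ) ^ j * (n + 1 - j) * (2 * n + 2).choose j =
      (-1) ^ (J + 1) * (n + 1) * ((2 * n).choose (J + 1) - (2 * n).choose J) := by
  have key : ∀ i : ℕ, ((2 * n).choose (i + 1) : ℤ) * (i + 1) = (2 * n).choose i * (2 * n - i) := by
    intro i
    rcases le_or_gt i (2 * n) with h | h
    · have := Nat.choose_succ_right_eq (2 * n) i
      zify [h] at this
      exact this
    · simp [Nat.choose_eq_zero_of_lt h, Nat.choose_eq_zero_of_lt (Nat.lt_succ_of_lt h)]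
  induction J with
  | zero =>
    simp [Finset.sum_range_succ]
    ring
  | succ J ih =>
    rw [Finset.sum_range_succ, ih]
    have e : (2 * n + 2).choose (J + 2) =
        (2 * n).choose (J + 2) + 2 * (2 * n).choose (J + 1) + (2 * n).choose J := by
      simp only [Nat.choose_succ_succ']
      ring
    have h1 := key J
    have h2 := key (J + 1)
    rw [e]
    push_cast at h2 ⊢
    simp only [add_assoc, Nat.reduceAdd, Int.reduceAdd] at *
    linear_combination (-1) ^ (J + 1) * (h2 + h1)

theorem sum_range_alternating_sub_mul_choose_self (n : ℕ) :
    ∑ j ∈ range (n + 1), (-1 : ℤ) ^ j * (n + 1 - j) * (2 * n + 2).choose j =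
      (-1) ^ n * (2 * n).choose n := by
  cases n with
  | zero => simp
  | succ m =>
    rw [show m + 1 + 1 = m + 2 from rfl, sum_range_alternating_sub_mul_choose]
    have := Nat.choose_succ_right_eq (2 * (m + 1)) m
    rw [show 2 * (m + 1) - m = m + 2 by omega] at this
    zify at this
    push_cast
    linear_combination (-1) ^ (m + 1) * this

theorem sum_range_choose_div_sub {F : Type*} [Field F] (n : ℕ)
    (hF : ∀ k : ℕ, k ≠ 0 → k ≤ 2 * n → (k : F) ≠ 0) :
    ∑ u ∈ range n, (-1 : F) ^ u * (2 * n).choose u / (n - u : F) =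
      -(-1) ^ n * (2 * n).choose n * ∑ k ∈ range (2 * n), (-1 : F) ^ k / (k + 1) := by
  induction n with
  | zero => simp
  | succ n ih =>
    specialize ih fun k hk hk' => hF k hk (by omega)
    have hn1 : (n + 1 : F) ≠ 0 := by exact_mod_cast hF (n + 1) (by omega) (by omega)
    have h2n1 : (2 * n + 1 : F) ≠ 0 := by exact_mod_cast hF (2 * n + 1) (by omega) (by omega)
    have h2n2 : (2 * n + 2 : F) ≠ 0 := by exact_mod_cast hF (2 * n + 2) (by omega) (by omega)
    have hcat := congrArg (Int.cast : ℤ → F) (sum_range_alternating_sub_mul_choose_self n)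
    push_cast at hcat
    have hstep : (n + 1 : F) ^ 2 * ∑ u ∈ range (n + 1),
        (-1 : F) ^ u * (2 * (n + 1)).choose u / ((n + 1 : ℕ) - u : F) =
        (-1) ^ n * (2 * n).choose n - (2 * n + 2) * (2 * n + 1) *
          ∑ u ∈ range n, (-1 : F) ^ u * (2 * n).choose u / (n - u : F) := by
      rw [← hcat, Finset.sum_range_succ' _ n, Finset.sum_range_succ' _ n, mul_add, Finset.mul_sum,
        Finset.mul_sum, add_sub_right_comm, ← Finset.sum_sub_distrib]
      congr 1
      · refine Finset.sum_congr rfl fun w hw => ?_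
        have hw := Finset.mem_range.mp hw
        have hd : (n - w : F) ≠ 0 := by
          have := hF (n - w) (by omega) (by omega)
          rwa [Nat.cast_sub hw.le] at this
        have c1 := Nat.add_one_mul_choose_eq (2 * n + 1) w
        have c4 := Nat.choose_mul_succ_eq (2 * n) w
        have c : ((2 * n + 2).choose (w + 1) * ((w + 1) * (2 * n + 1 - w)) : F) =
            (2 * n + 2) * (2 * n + 1) * (2 * n).choose w := by
          have c1' := congrArg (Nat.cast : ℕ → F) c1
          have c4' := congrArg (Nat.cast : ℕ → F) c4
          rw [Nat.cast_mul, Nat.cast_mul, Nat.cast_sub (by omega)] at c4'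
          push_cast at c1' c4'
          linear_combination -(2 * n + 1 - w : F) * c1' - (2 * n + 2 : F) * c4'
        rw [show 2 * (n + 1) = 2 * n + 2 from rfl]
        push_cast
        rw [show (n + 1 - (w + 1) : F) = n - w by ring]
        field_simp
        linear_combination -(-1) ^ w * c
      · simp
        field_simp
    have hC : ((2 * (n + 1)).choose (n + 1) : F) * (n + 1) ^ 2 =
        (2 * n + 2) * (2 * n + 1) * (2 * n).choose n := by
      have := congrArg (Nat.cast : ℕ → F) (Nat.succ_mul_centralBinom_succ n)
      rw [Nat.centralBinom, Nat.centralBinom] at this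
      push_cast at this
      linear_combination (n + 1 : F) * this
    have hsum : ∑ k ∈ range (2 * (n + 1)), (-1 : F) ^ k / (k + 1) =
        ∑ k ∈ range (2 * n), (-1 : F) ^ k / (k + 1) + 1 / ((2 * n + 1) * (2 * n + 2)) := by
      rw [show 2 * (n + 1) = 2 * n + 1 + 1 from rfl, Finset.sum_range_succ, Finset.sum_range_succ,
        add_assoc]
      congr 1
      push_cast
      rw [show (2 * n + 1 + 1 : F) = 2 * n + 2 by ring, pow_succ, pow_mul]
      rw [show ((-1 : F) ^ 2) ^ n = 1 by simp, one_mul, div_add_div _ _ h2n1 h2n2]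
      congr 1
      ring
    apply mul_left_cancel₀ (pow_ne_zero 2 hn1)
    rw [hstep, ih, hsum]
    have hh : (2 * n + 2) * (2 * n + 1) * (1 / ((2 * n + 1) * (2 * n + 2)) : F) = 1 := by
      rw [mul_comm (2 * n + 2 : F), mul_one_div_cancel (mul_ne_zero h2n1 h2n2)]
    generalize ∑ k ∈ range (2 * n), (-1 : F) ^ k / (k + 1) = s at *
    generalize (1 / ((2 * n + 1) * (2 * n + 2)) : F) = r at *
    linear_combination -(-1) ^ n * (s + r) * hC - (-1) ^ n * ((2 * n).choose n : F) * hh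

theorem two_mul_sum_range_alternating_choose {m : ℕ} (hm : m ≠ 0) :
    2 * ∑ u ∈ range m, (-1 : ℤ) ^ u * (2 * m).choose u = -(-1) ^ m * (2 * m).choose m := by
  obtain ⟨k, rfl⟩ := Nat.exists_eq_succ_of_ne_zero hm
  have h := Int.alternating_sum_range_choose_eq_choose (n := 2 * k + 1) (m := k)
  have h2 : (2 * k + 2).choose (k + 1) = 2 * (2 * k + 1).choose k := by
    rw [Nat.choose_succ_succ' (2 * k + 1) k, Nat.choose_symm_half]
    ring
  rw [Nat.succ_eq_add_one, show 2 * (k + 1) = 2 * k + 2 from rfl, h2, h]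
  push_cast
  ring

theorem sum_range_choose_sub_one_div_sub {F : Type*} [Field F] {n : ℕ} (hn : n ≠ 0)
    (hF : ∀ k : ℕ, k ≠ 0 → k ≤ 2 * n → (k : F) ≠ 0) :
    4 * n * ∑ u ∈ range n, (-1 : F) ^ u * (2 * n - 1).choose u / (n - u : F) =
      -(-1) ^ n * (2 * n).choose n *
        (2 * n * ∑ k ∈ range (2 * n), (-1 : F) ^ k / (k + 1) + 1) := by
  have h1 := sum_range_choose_div_sub n hF
  have h2 := congrArg (Int.cast : ℤ → F) (two_mul_sum_range_alternating_choose hn)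
  push_cast at h2
  have h3 : 2 * n * ∑ u ∈ range n, (-1 : F) ^ u * (2 * n - 1).choose u / (n - u : F) =
      n * ∑ u ∈ range n, (-1 : F) ^ u * (2 * n).choose u / (n - u : F) +
        ∑ u ∈ range n, (-1 : F) ^ u * (2 * n).choose u := by
    rw [Finset.mul_sum, Finset.mul_sum, ← Finset.sum_add_distrib]
    refine Finset.sum_congr rfl fun u hu => ?_
    have hu := Finset.mem_range.mp hu
    have hd : (n - u : F) ≠ 0 := by
      have := hF (n - u) (by omega) (by omega)
      rwa [Nat.cast_sub hu.le] at this
    have c := congrArg (Nat.cast : ℕ → F) (Nat.choose_mul_succ_eq (2 * n - 1) u)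
    rw [Nat.sub_add_cancel (by omega)] at c
    push_cast [Nat.cast_sub (show u ≤ 2 * n by omega)] at c
    field_simp
    linear_combination c
  linear_combination 2 * h3 + 2 * n * h1 + h2

theorem ZMod.natCast_choose_sub_one (p : ℕ) [Fact p.Prime] {k : ℕ} (hk : k < p) :
    ((p - 1).choose k : ZMod p) = (-1) ^ k := by
  have hp := (Fact.out : p.Prime)
  induction k with
  | zero => simp
  | succ k ih =>
    have h : (p.choose (k + 1) : ZMod p) = 0 :=
      (ZMod.natCast_eq_zero_iff _ _).mpr (hp.dvd_choose_self (by omega) hk)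
    have hpascal := Nat.choose_succ_succ' (p - 1) k
    rw [Nat.sub_add_cancel hp.one_le] at hpascal
    rw [hpascal, Nat.cast_add, ih (by omega)] at h
    rw [pow_succ]
    linear_combination h

/-- The coefficient of `t ^ (k + 1)` in `((1 - t) - (1 - t) ^ p) / p`, for `k + 1 < p`. -/
def fermatLogCoeff (p k : ℕ) : ℤ := (-1) ^ k * (p.choose (k + 1) / p : ℕ)

theorem fermatLogCoeff_cast (p : ℕ) [Fact p.Prime] {k : ℕ} (hk : k + 1 < p) :
    (fermatLogCoeff p k : ZMod p) = 1 / (k + 1) := by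
  have hp := (Fact.out : p.Prime)
  have hk0 : (k + 1 : ZMod p) ≠ 0 := by
    have : ((k + 1 : ℕ) : ZMod p) ≠ 0 := by
      rw [Ne, ZMod.natCast_eq_zero_iff]
      exact Nat.not_dvd_of_pos_of_lt (by omega) hk
    exact_mod_cast this
  obtain ⟨d, hd⟩ := hp.dvd_choose_self (k := k + 1) (by omega) hk
  have h : (p - 1).choose k = d * (k + 1) := by
    have h1 := Nat.add_one_mul_choose_eq (p - 1) k
    rw [Nat.sub_add_cancel hp.one_le, hd, mul_assoc] at h1
    exact Nat.eq_of_mul_eq_mul_left hp.pos h1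
  have h2 := ZMod.natCast_choose_sub_one p (k := k) (by omega)
  rw [h] at h2
  push_cast at h2
  rw [fermatLogCoeff, hd, Nat.mul_div_cancel_left _ hp.pos, eq_div_iff hk0]
  push_cast
  rw [mul_assoc, h2, ← mul_pow]
  simp

theorem one_sub_pow_prime_eq {R : Type*} [CommRing R] {p : ℕ} (hp : p.Prime) (hodd : Odd p)
    {t : R} (ht : t ^ p = t) :
    (1 - t) ^ p = (1 - t) - p * ∑ k ∈ range (p - 1), fermatLogCoeff p k * t ^ (k + 1) := by
  have hp1 : p - 1 + 1 = p := Nat.sub_add_cancel hp.one_le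
  have h : (1 - t) ^ p = ∑ k ∈ range (p + 1), (-t) ^ k * p.choose k := by
    rw [sub_eq_neg_add, add_pow]
    simp
  rw [h, Finset.sum_range_succ]
  nth_rewrite 1 [← hp1]
  rw [Finset.sum_range_succ', Finset.mul_sum, hodd.neg_pow, ht]
  have : ∀ k ∈ range (p - 1), (-t) ^ (k + 1) * (p.choose (k + 1) : R) =
      -(p * (fermatLogCoeff p k * t ^ (k + 1))) := by
    intro k hk
    obtain ⟨d, hd⟩ := hp.dvd_choose_self (k := k + 1) (by omega)
      (by have := Finset.mem_range.mp hk; omega)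
    rw [fermatLogCoeff, hd, Nat.mul_div_cancel_left _ hp.pos, neg_pow]
    push_cast
    ring
  rw [Finset.sum_congr rfl this, Finset.sum_neg_distrib]
  simp
  ring

theorem ZMod.fermatQuotient_two_eq (p m : ℕ) [Fact p.Prime] (hpm : p = 4 * m + 1) {Q : ℤ}
    (hQ : p * Q = 2 ^ (p - 1) - 1) :
    (Q : ZMod p) = ∑ k ∈ range (2 * m), (-1 : ZMod p) ^ k / (k + 1) := by
  have hp := (Fact.out : p.Prime)
  have hodd : Odd p := ⟨2 * m, by omega⟩
  have h := one_sub_pow_prime_eq (R := ℤ) hp hodd (t := -1) hodd.neg_one_pow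
  have h2 : 2 * Q = ∑ k ∈ range (p - 1), fermatLogCoeff p k * (-1) ^ k := by
    have hp0 : (p : ℤ) ≠ 0 := by exact_mod_cast hp.ne_zero
    apply mul_left_cancel₀ hp0
    simp only [pow_succ, mul_neg, mul_one, Finset.sum_neg_distrib] at h
    have h3 : (2 : ℤ) ^ p = 2 ^ (p - 1) * 2 := by
      rw [← pow_succ, Nat.sub_add_cancel hp.one_le]
    norm_num at h
    linear_combination 2 * hQ + h - h3
  have h3 := congrArg (Int.cast : ℤ → ZMod p) h2
  push_cast at h3
  have h4 : ∀ k ∈ range (p - 1), (fermatLogCoeff p k : ZMod p) * (-1) ^ k =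
      (-1) ^ k / (k + 1) := by
    intro k hk
    rw [fermatLogCoeff_cast p (by have := Finset.mem_range.mp hk; omega)]
    ring
  have hpz : (4 * m + 1 : ZMod p) = 0 := by
    exact_mod_cast (ZMod.natCast_eq_zero_iff (4 * m + 1) p).mpr (dvd_of_eq hpm)
  rw [Finset.sum_congr rfl h4, show p - 1 = 2 * m + 2 * m by omega, Finset.sum_range_add,
    ← Finset.sum_range_reflect (fun x => (-1 : ZMod p) ^ (2 * m + x) / ((2 * m + x : ℕ) + 1)),
    ← Finset.sum_add_distrib] at h3
  have h20 : (2 : ZMod p) ≠ 0 := by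
    have : ((2 : ℕ) : ZMod p) ≠ 0 := by
      rw [Ne, ZMod.natCast_eq_zero_iff]
      intro hd
      have := Nat.le_of_dvd (by norm_num) hd
      have := hp.two_le
      omega
    exact_mod_cast this
  apply mul_left_cancel₀ h20
  rw [h3, Finset.mul_sum]
  refine Finset.sum_congr rfl fun k hk => ?_
  have hk := Finset.mem_range.mp hk
  have e1 : ((2 * m + (2 * m - 1 - k) : ℕ) + 1 : ZMod p) = -(k + 1) := by
    have : 2 * m + (2 * m - 1 - k) + (k + 1) = 4 * m := by omega
    have := congrArg (Nat.cast : ℕ → ZMod p) this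
    push_cast at this ⊢
    linear_combination this + hpz
  have e2 : (-1 : ZMod p) ^ (2 * m + (2 * m - 1 - k)) = -(-1) ^ k := by
    have : (-1 : ZMod p) ^ (2 * m + (2 * m - 1 - k)) * (-1) ^ (k + 1) = 1 := by
      rw [← pow_add, show 2 * m + (2 * m - 1 - k) + (k + 1) = 2 * (2 * m) by omega, pow_mul]
      simp
    rw [pow_succ] at this
    have hs : (-1 : ZMod p) ^ k * (-1) ^ k = 1 := by rw [← mul_pow]; simp
    linear_combination -(-1) ^ k * this - (-1 : ZMod p) ^ (2 * m + (2 * m - 1 - k)) * hs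
  rw [e1, e2, neg_div_neg_eq]
  ring

theorem ZMod.sum_pow_mul_one_sub_pow_mul_log (p m : ℕ) [Fact p.Prime] (hpm : p = 4 * m + 1) :
    ∑ x : ZMod p, x ^ (3 * m) * ((1 - x) ^ (2 * m - 1) *
      ∑ k ∈ range (4 * m), 1 / (k + 1) * x ^ (k + 1)) =
      -2 * ∑ u ∈ range m, (-1) ^ u * (2 * m - 1).choose u / (m - u : ZMod p) := by
  have hp := (Fact.out : p.Prime)
  have hm : m ≠ 0 := by
    rintro rfl
    exact hp.ne_one (by omega)
  have hpz : (4 * m + 1 : ZMod p) = 0 := by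
    exact_mod_cast (ZMod.natCast_eq_zero_iff (4 * m + 1) p).mpr (dvd_of_eq hpm)
  have expand : ∀ x : ZMod p, x ^ (3 * m) * ((1 - x) ^ (2 * m - 1) *
      ∑ k ∈ range (4 * m), 1 / (k + 1) * x ^ (k + 1)) =
      ∑ u ∈ range (2 * m), ∑ k ∈ range (4 * m),
        (-1) ^ u * (2 * m - 1).choose u * (1 / (k + 1)) * x ^ (3 * m + u + k + 1) := by
    intro x
    rw [sub_eq_neg_add, add_pow, show 2 * m - 1 + 1 = 2 * m by omega, Finset.sum_mul_sum,
      Finset.mul_sum]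
    refine Finset.sum_congr rfl fun u _ => ?_
    rw [Finset.mul_sum]
    refine Finset.sum_congr rfl fun k _ => ?_
    rw [neg_pow, one_pow]
    ring
  rw [Finset.sum_congr rfl fun x _ => expand x, Finset.sum_comm]
  have inner : ∀ u k₀ : ℕ, k₀ < 4 * m →
      (∀ k < 4 * m, 4 * m ∣ 3 * m + u + k + 1 ↔ k = k₀) →
      ∑ x : ZMod p, ∑ k ∈ range (4 * m),
        (-1) ^ u * (2 * m - 1).choose u * (1 / (k + 1)) * x ^ (3 * m + u + k + 1) =
      -((-1) ^ u * (2 * m - 1).choose u / (k₀ + 1)) := by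
    intro u k₀ hk₀ hk
    rw [Finset.sum_comm, Finset.sum_eq_single_of_mem k₀ (Finset.mem_range.mpr hk₀)]
    · rw [← Finset.mul_sum, ZMod.sum_pow_eq_ite p (by omega), if_pos]
      · ring
      · rw [show p - 1 = 4 * m by omega]
        exact (hk k₀ hk₀).mpr rfl
    · intro k hk' hne
      rw [← Finset.mul_sum, ZMod.sum_pow_eq_ite p (by omega), if_neg, mul_zero]
      rw [show p - 1 = 4 * m by omega, hk k (Finset.mem_range.mp hk')]
      exact hne
  rw [two_mul m, Finset.sum_range_add, ← two_mul]
  have first : ∀ u ∈ range m, ∑ x : ZMod p, ∑ k ∈ range (4 * m),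
      (-1) ^ u * (2 * m - 1).choose u * (1 / (k + 1)) * x ^ (3 * m + u + k + 1) =
      -((-1) ^ u * (2 * m - 1).choose u / (m - u : ZMod p)) := by
    intro u hu
    have hu := Finset.mem_range.mp hu
    rw [inner u (m - u - 1) (by omega)]
    · rw [show ((m - u - 1 : ℕ) + 1 : ZMod p) = m - u by
        rw [← Nat.cast_sub hu.le, ← Nat.cast_add_one, Nat.sub_add_cancel (by omega)]]
    · intro k hk
      constructor
      · rintro ⟨c, hc⟩
        have h1 : c < 2 := by
          by_contra! h
          nlinarith
        have h2 : 0 < c := by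
          by_contra! h
          have : c = 0 := by omega
          subst this
          omega
        have : c = 1 := by omega
        subst this
        omega
      · rintro rfl
        exact ⟨1, by omega⟩
  have second : ∀ w ∈ range m, ∑ x : ZMod p, ∑ k ∈ range (4 * m),
      (-1) ^ (m + w) * (2 * m - 1).choose (m + w) * (1 / (k + 1)) *
        x ^ (3 * m + (m + w) + k + 1) =
      (-1) ^ (m + w) * (2 * m - 1).choose (m + w) / (w + 1 : ZMod p) := by
    intro w hw
    have hw := Finset.mem_range.mp hw
    rw [inner (m + w) (4 * m - w - 1) (by omega)]
    · rw [show ((4 * m - w - 1 : ℕ) + 1 : ZMod p) = -(w + 1) by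
        have : (4 * m - w - 1) + 1 + w = 4 * m := by omega
        have := congrArg (Nat.cast : ℕ → ZMod p) this
        push_cast at this
        linear_combination this + hpz, div_neg, neg_neg]
    · intro k hk
      constructor
      · rintro ⟨c, hc⟩
        have h1 : c < 3 := by
          by_contra! h
          nlinarith
        have h2 : 1 < c := by
          by_contra! h
          nlinarith
        have : c = 2 := by omega
        subst this
        omega
      · rintro rfl
        exact ⟨2, by omega⟩
  rw [Finset.sum_congr rfl first, Finset.sum_congr rfl second,
    ← Finset.sum_range_reflect (fun w => (-1 : ZMod p) ^ (m + w) * _ / _), neg_mul,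
    Finset.mul_sum, ← Finset.sum_neg_distrib, ← Finset.sum_add_distrib]
  refine Finset.sum_congr rfl fun w hw => ?_
  have hw := Finset.mem_range.mp hw
  have e0 : m + (m - 1 - w) = 2 * m - 1 - w := by omega
  have e1 : ((m - 1 - w : ℕ) + 1 : ZMod p) = m - w := by
    have : (m - 1 - w) + 1 + w = m := by omega
    have := congrArg (Nat.cast : ℕ → ZMod p) this
    push_cast at this
    linear_combination this
  have e2 : (-1 : ZMod p) ^ (2 * m - 1 - w) = -(-1) ^ w := by
    have : (-1 : ZMod p) ^ (2 * m - 1 - w) * (-1) ^ (w + 1) = 1 := by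
      rw [← pow_add, show 2 * m - 1 - w + (w + 1) = 2 * m by omega, pow_mul]
      simp
    rw [pow_succ] at this
    have hs : (-1 : ZMod p) ^ w * (-1) ^ w = 1 := by rw [← mul_pow]; simp
    linear_combination -(-1) ^ w * this - (-1 : ZMod p) ^ (2 * m - 1 - w) * hs
  rw [e0, e1, e2, Nat.choose_symm (by omega)]
  ring

theorem teichmullerChar_pow_card (p : ℕ) [Fact p.Prime] (x : ZMod p) :
    teichmullerChar p x ^ p = teichmullerChar p x := by
  rw [← map_pow, ZMod.pow_card]

theorem PadicInt.dvd_iff_toZMod_eq_zero (p : ℕ) [Fact p.Prime] (z : ℤ_[p]) :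
    (p : ℤ_[p]) ∣ z ↔ PadicInt.toZMod z = 0 := by
  rw [← RingHom.mem_ker, PadicInt.ker_toZMod, PadicInt.maximalIdeal_eq_span_p,
    Ideal.mem_span_singleton]

theorem sq_dvd_teichmullerChar_one_sub_pow_sub (p n : ℕ) [Fact p.Prime] (hodd : Odd p)
    (x : ZMod p) :
    (p : ℤ_[p]) ^ 2 ∣ teichmullerChar p (1 - x) ^ n -
      ((1 - teichmullerChar p x) ^ n - n * p * ((1 - teichmullerChar p x) ^ (n - 1) *
        ∑ k ∈ range (p - 1), fermatLogCoeff p k * teichmullerChar p x ^ (k + 1))) := by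
  set t := teichmullerChar p x
  have hp := (Fact.out : p.Prime)
  have h1 : (p : ℤ_[p]) ∣ teichmullerChar p (1 - x) - (1 - t) := by
    simp [PadicInt.dvd_iff_toZMod_eq_zero, toZMod_teichmullerChar, t]
  have h2 := dvd_sub_pow_of_dvd_sub h1 1
  rw [pow_one, teichmullerChar_pow_card, one_sub_pow_prime_eq hp hodd
    (teichmullerChar_pow_card p x)] at h2
  have h3 := h2.trans (sub_dvd_pow_sub_pow _ _ n)
  generalize ∑ k ∈ range (p - 1), (fermatLogCoeff p k : ℤ_[p]) * t ^ (k + 1) = L at *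
  obtain ⟨c, hc⟩ := Polynomial.powAddExpansion (1 - t) (-(p * L)) n
  have h4 : (p : ℤ_[p]) ^ 2 ∣ (1 - t - p * L) ^ n -
      ((1 - t) ^ n - n * p * ((1 - t) ^ (n - 1) * L)) := by
    rw [sub_eq_add_neg (1 - t), hc]
    exact ⟨c * L ^ 2, by ring⟩
  convert dvd_add h3 h4 using 1
  ring

theorem sum_teichmullerChar_pow_mul_one_sub_pow (p m : ℕ) [Fact p.Prime] (hpm : p = 4 * m + 1) :
    ∑ x : ZMod p, teichmullerChar p x ^ (3 * m) * (1 - teichmullerChar p x) ^ (2 * m) =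
      (p - 1) * ((-1) ^ m * (2 * m).choose m) := by
  have hp := (Fact.out : p.Prime)
  have hm : m ≠ 0 := by
    rintro rfl
    exact hp.ne_one (by omega)
  have expand : ∀ t : ℤ_[p], t ^ (3 * m) * (1 - t) ^ (2 * m) =
      ∑ u ∈ range (2 * m + 1), (-1) ^ u * (2 * m).choose u * t ^ (3 * m + u) := by
    intro t
    rw [sub_eq_neg_add, add_pow, Finset.mul_sum]
    refine Finset.sum_congr rfl fun u _ => ?_
    rw [neg_pow, one_pow]
    ring
  rw [Finset.sum_congr rfl fun x _ => expand _, Finset.sum_comm,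
    Finset.sum_eq_single_of_mem m (Finset.mem_range.mpr (by omega))]
  · rw [← Finset.mul_sum, sum_teichmullerChar_pow p (by omega), if_pos ⟨1, by omega⟩]
    ring
  · intro u hu hne
    have hu := Finset.mem_range.mp hu
    rw [← Finset.mul_sum, sum_teichmullerChar_pow p (by omega), if_neg, mul_zero]
    rintro ⟨c, hc⟩
    rw [show p - 1 = 4 * m by omega] at hc
    have h1 : c < 2 := by
      by_contra! h
      have := Nat.mul_le_mul_left m h
      have := Nat.pos_of_ne_zero hm
      nlinarith
    interval_cases c <;> omega

/-- The Jacobi sum of `ω³ᵐ` and `ω²ᵐ` modulo `p²`, where `p = 4 m + 1` and `ω` is the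
Teichmüller character. -/
theorem sq_dvd_two_mul_jacobiSum_add (p m : ℕ) [Fact p.Prime] (hpm : p = 4 * m + 1) {Q : ℤ}
    (hQ : p * Q = 2 ^ (p - 1) - 1) :
    (p : ℤ_[p]) ^ 2 ∣ 2 * jacobiSum (teichmullerChar p ^ (3 * m)) (teichmullerChar p ^ (2 * m)) +
      (-1) ^ m * (2 * m).choose m * (2 - p * Q) := by
  have hp := (Fact.out : p.Prime)
  have hm : m ≠ 0 := by
    rintro rfl
    exact hp.ne_one (by omega)
  have hpz : (4 * m + 1 : ZMod p) = 0 := by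
    exact_mod_cast (ZMod.natCast_eq_zero_iff (4 * m + 1) p).mpr (dvd_of_eq hpm)
  set S : ℤ_[p] := ∑ x : ZMod p, teichmullerChar p x ^ (3 * m) *
    ((1 - teichmullerChar p x) ^ (2 * m - 1) *
      ∑ k ∈ range (p - 1), fermatLogCoeff p k * teichmullerChar p x ^ (k + 1)) with hS
  have hJ : (p : ℤ_[p]) ^ 2 ∣ jacobiSum (teichmullerChar p ^ (3 * m)) (teichmullerChar p ^ (2 * m))
      - ((p - 1) * ((-1) ^ m * (2 * m).choose m) - (2 * m : ℕ) * p * S) := by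
    rw [← sum_teichmullerChar_pow_mul_one_sub_pow p m hpm, hS, jacobiSum, Finset.mul_sum,
      ← Finset.sum_sub_distrib, ← Finset.sum_sub_distrib]
    refine Finset.dvd_sum fun x _ => ?_
    rw [MulChar.pow_apply' _ (by omega), MulChar.pow_apply' _ (by omega)]
    convert (sq_dvd_teichmullerChar_one_sub_pow_sub p (2 * m) ⟨2 * m, by omega⟩ x).mul_left
      (teichmullerChar p x ^ (3 * m)) using 1
    ring
  have hSz : PadicInt.toZMod S =
      -2 * ∑ u ∈ range m, (-1) ^ u * (2 * m - 1).choose u / (m - u : ZMod p) := by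
    rw [← ZMod.sum_pow_mul_one_sub_pow_mul_log p m hpm, hS, map_sum]
    refine Finset.sum_congr rfl fun x _ => ?_
    simp only [map_mul, map_pow, map_sub, map_one, map_sum, map_intCast, toZMod_teichmullerChar]
    rw [show p - 1 = 4 * m by omega]
    congr 2
    refine Finset.sum_congr rfl fun k hk => ?_
    rw [fermatLogCoeff_cast p (by have := Finset.mem_range.mp hk; omega)]
  have hT := sum_range_choose_sub_one_div_sub (F := ZMod p) hm (by
    intro k hk hk'
    rw [Ne, ZMod.natCast_eq_zero_iff]
    exact Nat.not_dvd_of_pos_of_lt (by omega) (by omega))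
  rw [← ZMod.fermatQuotient_two_eq p m hpm hQ] at hT
  have hmod : (p : ℤ_[p]) ∣ 2 * ((-1) ^ m * (2 * m).choose m) - 4 * m * S -
      (-1) ^ m * (2 * m).choose m * Q := by
    rw [PadicInt.dvd_iff_toZMod_eq_zero]
    simp only [map_mul, map_pow, map_sub, map_neg, map_one, map_natCast, map_intCast, map_ofNat,
      hSz]
    linear_combination 2 * hT - (-1) ^ m * ((2 * m).choose m : ZMod p) * Q * hpz
  obtain ⟨c, hc⟩ := hJ
  obtain ⟨d, hd⟩ := hmod
  refine ⟨2 * c + d, ?_⟩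
  push_cast at hc
  linear_combination 2 * hc + p * hd

theorem sq_eq_sq_of_prime_eq_sq_add_sq_s5 {p : ℕ} (hp : p.Prime) {a b A B : ℤ}
    (hab : (p : ℤ) = a ^ 2 + b ^ 2) (hAB : (p : ℤ) = A ^ 2 + B ^ 2) (ha : Odd a) (hb : Even b)
    (hA : Odd A) (hB : Even B) : A ^ 2 = a ^ 2 := by
  have hpz : Prime (p : ℤ) := Nat.prime_iff_prime_int.mp hp
  have key : ∀ B' : ℤ, (p : ℤ) = A ^ 2 + B' ^ 2 → Even B' → (p : ℤ) ∣ a * B' - b * A →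
      A ^ 2 = a ^ 2 := by
    rintro B' hAB' hB' ⟨c, hc⟩
    have hbr : (a * A + b * B') ^ 2 + (p * c) ^ 2 = (p : ℤ) ^ 2 := by
      rw [← hc]
      nth_rewrite 1 [pow_two (p : ℤ)]
      nth_rewrite 1 [hab]
      rw [hAB']
      ring
    have hodd : Odd (a * A + b * B') := (ha.mul hA).add_even (hb.mul_right _)
    have hpos : 0 < (a * A + b * B') ^ 2 := by
      have : a * A + b * B' ≠ 0 := by
        intro h0
        rw [h0] at hodd
        exact absurd hodd (by decide)
      positivity
    have hpp : (0 : ℤ) < (p : ℤ) ^ 2 := by have := hp.pos; positivity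
    have hc0 : c = 0 := by
      by_contra h
      have : 1 ≤ c ^ 2 := by
        have : 0 < c ^ 2 := by positivity
        omega
      nlinarith
    rw [hc0, mul_zero, sub_eq_zero] at hc
    apply mul_left_cancel₀ hpz.ne_zero
    have h2 : (a * B') ^ 2 = (b * A) ^ 2 := by rw [hc]
    linear_combination A ^ 2 * hab - a ^ 2 * hAB' - h2
  have hdvd : (p : ℤ) ∣ (a * B - b * A) * (a * -B - b * A) := by
    refine ⟨A ^ 2 - a ^ 2, ?_⟩
    linear_combination a ^ 2 * hAB - A ^ 2 * hab
  rcases hpz.dvd_or_dvd hdvd with h | h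
  · exact key B hAB hB h
  · exact key (-B) (by rw [hAB]; ring) hB.neg h

theorem eq_neg_one_pow_mul_of_prime_eq_sq_add_sq {p m : ℕ} (hp : p.Prime) (hpm : p = 4 * m + 1)
    {a b A B : ℤ} (hab : (p : ℤ) = a ^ 2 + b ^ 2) (ha : a ≡ 1 [ZMOD 4])
    (hAB : (p : ℤ) = A ^ 2 + B ^ 2) (hB : Even B) (hABmod : A + p ≡ B [ZMOD 4]) :
    A = -(-1) ^ m * a := by
  have ha4 : a % 4 = 1 := ha
  have hAB4 : (A + p) % 4 = B % 4 := hABmod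
  obtain ⟨B', rfl⟩ := hB
  have haodd : Odd a := Int.odd_iff.mpr (by omega)
  have hpz : (p : ℤ) = 4 * m + 1 := by exact_mod_cast hpm
  have hbeven : Even b := by
    have h1 : Even (b ^ 2) := by
      have h2 : Odd (p : ℤ) := ⟨2 * m, by rw [hpz]; ring⟩
      rw [show b ^ 2 = p - a ^ 2 by linarith]
      exact h2.sub_odd haodd.pow
    exact (Int.even_pow.mp h1).1
  have hsq := sq_eq_sq_of_prime_eq_sq_add_sq_s5 hp hab hAB haodd hbeven
    (Int.odd_iff.mpr (by omega)) ⟨B', rfl⟩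
  obtain ⟨k, hk⟩ : ∃ k, a = 4 * k + 1 := ⟨a / 4, by omega⟩
  have hm : (m : ℤ) = 4 * k ^ 2 + 2 * k + B' ^ 2 := by
    rw [hsq, hk] at hAB
    linarith [hAB, hpz, show (4 * k + 1) ^ 2 + (B' + B') ^ 2 =
      4 * (4 * k ^ 2 + 2 * k + B' ^ 2) + 1 by ring]
  have hpar : (Even (m : ℤ)) ↔ Even B' := by
    rw [hm]
    simp [Int.even_add, Int.even_pow, show Even (4 : ℤ) by decide]
  rw [Int.even_coe_nat] at hpar
  rcases sq_eq_sq_iff_eq_or_eq_neg.mp hsq with h | h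
  · have : ¬ Even B' := by
      rintro ⟨r, rfl⟩
      omega
    rw [Odd.neg_one_pow (Nat.not_even_iff_odd.mp (fun h => this (hpar.mp h))), h]
    ring
  · have : Even B' := by
      by_contra hc
      obtain ⟨r, rfl⟩ := Int.not_even_iff_odd.mp hc
      omega
    rw [Even.neg_one_pow (hpar.mpr this), h]
    ring

theorem jacobiSum_add_card {F R : Type*} [Field F] [Fintype F] [CommRing R] [IsDomain R]
    {χ ψ : MulChar F R} (hχ : χ ≠ 1) (hψ : ψ ≠ 1) :
    jacobiSum χ ψ + Fintype.card F = ∑ x, (χ x - 1) * (ψ (1 - x) - 1) := by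
  have h : ∑ x, ψ (1 - x) = 0 := by
    rw [← MulChar.sum_eq_zero_of_ne_one hψ]
    exact (Equiv.subLeft (1 : F)).sum_comp fun x => ψ x
  simp only [sub_mul, mul_sub, mul_one, one_mul, Finset.sum_sub_distrib,
    MulChar.sum_eq_zero_of_ne_one hχ, h, jacobiSum]
  simp

/-- The Jacobi sums attached to the quartic characters `ωᵐ`, `ω³ᵐ` are conjugate Gaussian
integers, congruent to `-p` modulo `2 (i - 1)`. -/
theorem exists_jacobiSum_teichmullerChar_eq (p m : ℕ) [Fact p.Prime] (hpm : p = 4 * m + 1) :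
    ∃ (ι : ℤ_[p]) (c d : ℤ), ι ^ 2 = -1 ∧
      jacobiSum (teichmullerChar p ^ (3 * m)) (teichmullerChar p ^ (2 * m)) + p =
        2 * (ι - 1) * (c + d * ι) ∧
      jacobiSum (teichmullerChar p ^ m) (teichmullerChar p ^ (2 * m)) + p =
        2 * (-ι - 1) * (c - d * ι) := by
  have hp := (Fact.out : p.Prime)
  have hm : m ≠ 0 := by
    rintro rfl
    exact hp.ne_one (by omega)
  have hnd : ∀ j, 0 < j → j < 4 → ¬ (p - 1) ∣ j * m := by
    intro j hj hj' h
    have := Nat.le_of_dvd (Nat.mul_pos hj (Nat.pos_of_ne_zero hm)) h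
    have := Nat.mul_lt_mul_of_pos_right hj' (Nat.pos_of_ne_zero hm)
    omega
  have hfour : ∀ x : ZMod p, x ≠ 0 → (teichmullerChar p x ^ m) ^ 4 = 1 := by
    intro x hx
    rw [← pow_mul, mul_comm, show 4 * m = p - 1 by omega, teichmullerChar_pow_card_sub_one p hx]
  have hsq : ∀ y : ℤ_[p], y ^ 4 = 1 → y ^ 2 = 1 ∨ y ^ 2 = -1 := by
    intro y hy
    rw [← sq_eq_sq_iff_eq_or_eq_neg]
    linear_combination hy
  obtain ⟨ι, hι⟩ : ∃ ι : ℤ_[p], ι ^ 2 = -1 := by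
    obtain ⟨x, hx⟩ := (MulChar.ne_one_iff).mp
      (teichmullerChar_pow_ne_one p (hnd 2 (by norm_num) (by norm_num)))
    rw [MulChar.pow_apply_coe, mul_comm, pow_mul] at hx
    exact ⟨_, (hsq _ (hfour x x.ne_zero)).resolve_left hx⟩
  have hroots : ∀ y : ℤ_[p], y ^ 4 = 1 → y = 1 ∨ y = -1 ∨ y = ι ∨ y = -ι := by
    intro y hy
    rcases hsq y hy with h | h
    · rcases sq_eq_sq_iff_eq_or_eq_neg.mp (h.trans (one_pow 2).symm) with h | h <;> simp [h]
    · rw [← hι, sq_eq_sq_iff_eq_or_eq_neg] at h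
      tauto
  have hterm : ∀ x : ZMod p, ∃ c d : ℤ,
      ((teichmullerChar p x ^ m) ^ 3 - 1) * ((teichmullerChar p (1 - x) ^ m) ^ 2 - 1) =
        2 * (ι - 1) * (c + d * ι) ∧
      (teichmullerChar p x ^ m - 1) * ((teichmullerChar p (1 - x) ^ m) ^ 2 - 1) =
        2 * (-ι - 1) * (c - d * ι) := by
    intro x
    rcases eq_or_ne x 0 with rfl | hx0
    · exact ⟨0, 0, by simp⟩
    rcases eq_or_ne x 1 with rfl | hx1
    · exact ⟨0, 0, by simp⟩
    have hy := hroots _ (hfour x hx0)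
    have hz := hsq _ (hfour (1 - x) (sub_ne_zero.mpr hx1.symm))
    generalize teichmullerChar p x ^ m = y at *
    generalize teichmullerChar p (1 - x) ^ m = z at *
    rcases hz with hz | hz
    · exact ⟨0, 0, by simp [hz]⟩
    have hι3 : ι ^ 3 = -ι := by linear_combination ι * hι
    rw [hz]
    rcases hy with rfl | rfl | rfl | rfl
    · exact ⟨0, 0, by simp⟩
    · refine ⟨-1, -1, ?_, ?_⟩ <;> push_cast <;> linear_combination 2 * hι
    · refine ⟨0, -1, ?_, ?_⟩ <;> push_cast
      · linear_combination -2 * hι3 + 2 * hι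
      · linear_combination 2 * hι
    · refine ⟨-1, 0, ?_, ?_⟩ <;> push_cast
      · linear_combination 2 * hι3
      · ring
  choose c d hc hd using hterm
  refine ⟨ι, ∑ x, c x, ∑ x, d x, hι, ?_, ?_⟩
  · have h := jacobiSum_add_card
      (teichmullerChar_pow_ne_one p (hnd 3 (by norm_num) (by norm_num)))
      (teichmullerChar_pow_ne_one p (hnd 2 (by norm_num) (by norm_num)))
    rw [ZMod.card] at h
    push_cast
    rw [h, Finset.sum_mul, ← Finset.sum_add_distrib, Finset.mul_sum]
    refine Finset.sum_congr rfl fun x _ => ?_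
    rw [← hc, MulChar.pow_apply' _ (by omega), MulChar.pow_apply' _ (by omega), mul_comm 3,
      mul_comm 2, pow_mul, pow_mul]
  · have h := jacobiSum_add_card
      (teichmullerChar_pow_ne_one p (hnd 1 (by norm_num) (by norm_num)))
      (teichmullerChar_pow_ne_one p (hnd 2 (by norm_num) (by norm_num)))
    rw [ZMod.card, one_mul] at h
    push_cast
    rw [h, Finset.sum_mul, ← Finset.sum_sub_distrib, Finset.mul_sum]
    refine Finset.sum_congr rfl fun x _ => ?_
    rw [← hd, MulChar.pow_apply' _ (by omega), MulChar.pow_apply' _ (by omega), mul_comm 2,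
      pow_mul]

theorem jacobiSum_teichmullerChar_mul_eq (p m : ℕ) [Fact p.Prime] (hpm : p = 4 * m + 1) :
    jacobiSum (teichmullerChar p ^ (3 * m)) (teichmullerChar p ^ (2 * m)) *
      jacobiSum (teichmullerChar p ^ m) (teichmullerChar p ^ (2 * m)) = p := by
  have hp := (Fact.out : p.Prime)
  have hm : 0 < m := by
    rcases Nat.eq_zero_or_pos m with rfl | h
    · exact absurd (by omega) hp.ne_one
    · exact h
  let f : ℤ_[p] →+* ℚ_[p] := PadicInt.Coe.ringHom
  have hf : Function.Injective f := Subtype.coe_injective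
  have hT : teichmullerChar p ^ (4 * m) = 1 := by
    ext x
    rw [MulChar.pow_apply_coe, MulChar.one_apply_coe, show 4 * m = p - 1 by omega,
      teichmullerChar_pow_card_sub_one p x.ne_zero]
  have hi1 : (teichmullerChar p ^ (3 * m))⁻¹ = teichmullerChar p ^ m := by
    rw [inv_eq_iff_mul_eq_one, ← pow_add, ← hT]
    congr 1
    ring
  have hi2 : (teichmullerChar p ^ (2 * m))⁻¹ = teichmullerChar p ^ (2 * m) := by
    rw [inv_eq_iff_mul_eq_one, ← pow_add, ← hT]
    congr 1
    ring
  have hnd : ∀ e, 0 < e → e < 4 * m → teichmullerChar p ^ e ≠ 1 := by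
    intro e he he'
    apply teichmullerChar_pow_ne_one
    intro h
    have := Nat.le_of_dvd he h
    omega
  have hmul : teichmullerChar p ^ (3 * m) * teichmullerChar p ^ (2 * m) = teichmullerChar p ^ m := by
    rw [← pow_add, show 3 * m + 2 * m = 4 * m + m by ring, pow_add, hT, one_mul]
  have h := jacobiSum_mul_jacobiSum_inv (F := ZMod p) (F' := ℚ_[p])
    (χ := (teichmullerChar p ^ (3 * m)).ringHomComp f)
    (φ := (teichmullerChar p ^ (2 * m)).ringHomComp f)
    (by rw [ringChar.eq_zero, ZMod.ringChar_zmod_n]; exact hp.ne_zero.symm)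
    ((MulChar.ringHomComp_ne_one_iff hf).mpr (hnd _ (by omega) (by omega)))
    ((MulChar.ringHomComp_ne_one_iff hf).mpr (hnd _ (by omega) (by omega)))
    (by
      rw [← MulChar.ringHomComp_mul, hmul]
      exact (MulChar.ringHomComp_ne_one_iff hf).mpr (hnd _ (by omega) (by omega)))
  rw [MulChar.ringHomComp_inv, MulChar.ringHomComp_inv, hi1, hi2, jacobiSum_ringHomComp,
    jacobiSum_ringHomComp, ← map_mul, ZMod.card, ← map_natCast f] at h
  exact hf h

theorem PadicInt.isUnit_of_toZMod_ne_zero {p : ℕ} [Fact p.Prime] {z : ℤ_[p]}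
    (hz : PadicInt.toZMod z ≠ 0) : IsUnit z := by
  rwa [← IsLocalRing.notMem_maximalIdeal, ← PadicInt.ker_toZMod, RingHom.mem_ker]

/-- Beukers–Chowla–Dwork–Evans: for a prime `p ≡ 1 (mod 4)` with `p = a² + b²`,
`a ≡ 1 (mod 4)`, and `q_p(2) = (2^{p-1}-1)/p`,
`C((p-1)/2, (p-1)/4) ≡ (1 + ½ p q_p(2))(2a - p/(2a)) (mod p²)` in `ℤ_p`. -/
theorem beukers_cde_congruence (p : ℕ) [hp : Fact p.Prime] (hp4 : p % 4 = 1)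
    (a b : ℤ) (hab : (p : ℤ) = a ^ 2 + b ^ 2) (ha : a ≡ 1 [ZMOD 4])
    (q : ℚ) (hq : q = ((2 ^ (p - 1) - 1 : ℚ)) / p) :
    ∃ z : ℤ_[p],
      (Nat.choose ((p - 1) / 2) ((p - 1) / 4) : ℚ_[p]) -
        (1 + (1 / 2) * (p : ℚ_[p]) * (q : ℚ_[p])) *
          (2 * (a : ℚ_[p]) - (p : ℚ_[p]) / (2 * (a : ℚ_[p])))
      = (p : ℚ_[p]) ^ 2 * (z : ℚ_[p]) := by
  have hprime := hp.out
  obtain ⟨m, hpm⟩ : ∃ m, p = 4 * m + 1 := ⟨p / 4, by omega⟩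
  have hm : m ≠ 0 := by
    rintro rfl
    exact hprime.ne_one (by omega)
  rw [show (p - 1) / 2 = 2 * m by omega, show (p - 1) / 4 = m by omega]
  have h2 : (2 : ZMod p) ≠ 0 := by
    have : ((2 : ℕ) : ZMod p) ≠ 0 := by
      rw [Ne, ZMod.natCast_eq_zero_iff]
      exact Nat.not_dvd_of_pos_of_lt (by norm_num) (by omega)
    exact_mod_cast this
  have hC : ((2 * m).choose m : ZMod p) ≠ 0 := by
    rw [Ne, ZMod.natCast_eq_zero_iff]
    intro h
    have hfac := Nat.choose_mul_factorial_mul_factorial (show m ≤ 2 * m by omega)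
    have : p ∣ (2 * m).factorial := hfac ▸ (h.mul_right _).mul_right _
    have := (hprime.dvd_factorial).mp this
    omega
  obtain ⟨Q, hQ⟩ : ∃ Q : ℤ, p * Q = 2 ^ (p - 1) - 1 := by
    have h : (p : ℤ) ∣ 2 ^ (p - 1) - 1 := by
      rw [← ZMod.intCast_zmod_eq_zero_iff_dvd]
      push_cast
      rw [ZMod.pow_card_sub_one_eq_one h2, sub_self]
    exact ⟨_, h.choose_spec.symm⟩
  have hqQ : q = (Q : ℚ) := by
    have hp0 : (p : ℚ) ≠ 0 := by exact_mod_cast hprime.ne_zero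
    rw [hq, div_eq_iff hp0]
    have : ((p * Q : ℤ) : ℚ) = ((2 ^ (p - 1) - 1 : ℤ) : ℚ) := by rw [hQ]
    push_cast at this
    linear_combination -this
  obtain ⟨z, hz⟩ := sq_dvd_two_mul_jacobiSum_add p m hpm hQ
  have hnorm := jacobiSum_teichmullerChar_mul_eq p m hpm
  obtain ⟨ι, c, d, hι, hJ, hJ'⟩ := exists_jacobiSum_teichmullerChar_eq p m hpm
  generalize jacobiSum (teichmullerChar p ^ (3 * m)) (teichmullerChar p ^ (2 * m)) = J at *
  generalize jacobiSum (teichmullerChar p ^ m) (teichmullerChar p ^ (2 * m)) = J' at *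
  have hAB : (p : ℤ) = (-p - 2 * (c + d)) ^ 2 + (2 * (c - d)) ^ 2 := by
    have : ((p : ℤ) : ℤ_[p]) = (((-p - 2 * (c + d)) ^ 2 + (2 * (c - d)) ^ 2 : ℤ) : ℤ_[p]) := by
      push_cast
      have e : J = (-p - 2 * (c + d)) + 2 * (c - d) * ι := by linear_combination hJ + 2 * d * hι
      have e' : J' = (-p - 2 * (c + d)) - 2 * (c - d) * ι := by
        linear_combination hJ' + 2 * d * hι
      linear_combination -hnorm + J' * e + (-p - 2 * (c + d) + 2 * (c - d) * ι) * e' -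
        (2 * (c - d)) ^ 2 * hι
    exact_mod_cast this
  have hA := eq_neg_one_pow_mul_of_prime_eq_sq_add_sq hprime hpm hab ha hAB (even_two_mul _)
    ((Int.modEq_iff_dvd).mpr ⟨c, by ring⟩)
  have hA' : (-p - 2 * (c + d) : ℤ_[p]) = -(-1) ^ m * a := by
    have := congrArg (Int.cast : ℤ → ℤ_[p]) hA
    push_cast at this
    exact this
  have hε : ((-1 : ℤ_[p]) ^ m) * (-1) ^ m = 1 := by rw [← mul_pow]; simp
  obtain ⟨π, hπ⟩ : ∃ π, π = -(-1) ^ m * J := ⟨_, rfl⟩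
  obtain ⟨π', hπ'⟩ : ∃ π', π' = -(-1) ^ m * J' := ⟨_, rfl⟩
  have hadd : π + π' = 2 * a := by
    rw [hπ, hπ', eq_sub_of_add_eq hJ, eq_sub_of_add_eq hJ']
    linear_combination -2 * (-1) ^ m * hA' - 4 * (-1) ^ m * d * hι + 2 * a * hε
  have hmul : π * π' = p := by
    rw [hπ, hπ']
    linear_combination hnorm + J * J' * hε
  have hcong : (2 * m).choose m * (2 - p * Q) - 2 * π = (p : ℤ_[p]) ^ 2 * ((-1) ^ m * z) := by
    rw [hπ]
    linear_combination (-1) ^ m * hz - ((2 * m).choose m : ℤ_[p]) * (2 - p * Q) * hε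
  have hπ0 : PadicInt.toZMod π = ((2 * m).choose m : ZMod p) := by
    have := congrArg PadicInt.toZMod hcong
    simp only [map_mul, map_sub, map_natCast, map_ofNat, map_intCast, map_pow,
      CharP.cast_eq_zero (ZMod p) p] at this
    apply mul_left_cancel₀ h2
    linear_combination -this
  have hπ'0 : PadicInt.toZMod π' = 0 := by
    have := congrArg PadicInt.toZMod hmul
    rw [map_mul, hπ0, map_natCast, CharP.cast_eq_zero (ZMod p) p] at this
    exact (mul_eq_zero.mp this).resolve_left hC
  obtain ⟨w, hw⟩ := (PadicInt.isUnit_of_toZMod_ne_zero (hπ0 ▸ hC)).exists_right_inv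
  obtain ⟨v, hv⟩ : ∃ v, (2 * a : ℤ_[p]) * v = 1 := by
    refine (PadicInt.isUnit_of_toZMod_ne_zero ?_).exists_right_inv
    rw [← hadd, map_add, hπ'0, add_zero, hπ0]
    exact hC
  obtain ⟨h, hh⟩ : ∃ h, (2 : ℤ_[p]) * h = 1 :=
    (PadicInt.isUnit_of_toZMod_ne_zero (by rwa [map_ofNat])).exists_right_inv
  have hπw : π' = p * w := by linear_combination w * hmul - π' * hw
  have hquot : 2 * a - p * v = π + p ^ 2 * (w ^ 2 * v) := by
    linear_combination -hadd + hπw + p * v * w * hπw - p * v * w * hadd - p * w * hv + p * v * hw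
  have hfinal : (2 * m).choose m - (1 + h * p * Q) * (2 * a - p * v) =
      (p : ℤ_[p]) ^ 2 * ((2 * m).choose m * (h * Q) ^ 2 +
        (1 + h * p * Q) * (h * ((-1) ^ m * z) - w ^ 2 * v)) := by
    rw [hquot]
    linear_combination (1 + h * p * Q) * h * hcong +
      (1 + h * p * Q) * (π - ((2 * m).choose m : ℤ_[p])) * hh
  refine ⟨_, Eq.trans ?_ (congrArg (PadicInt.Coe.ringHom : ℤ_[p] →+* ℚ_[p]) hfinal |>.trans
    (map_mul _ _ _ |>.trans (congrArg (· * _) (by rw [map_pow, map_natCast]))))⟩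
  have hh' := congrArg (PadicInt.Coe.ringHom : ℤ_[p] →+* ℚ_[p]) hh
  have hv' := congrArg (PadicInt.Coe.ringHom : ℤ_[p] →+* ℚ_[p]) hv
  simp only [map_mul, map_ofNat, map_one, map_intCast] at hh' hv'
  simp only [map_sub, map_mul, map_add, map_natCast, map_intCast, map_ofNat, map_one]
  rw [eq_one_div_of_mul_eq_one_right hh', eq_one_div_of_mul_eq_one_right hv', hqQ,
    Rat.cast_intCast, mul_one_div]
end

section
/- Let p be a prime with p ≡ 1 (mod 6), and write 4p = r^2 + 27 s^2 with r ≡ 1 (mod 3). Then C(2(p-1)/3, (p-1)/3) ≡ -r + p/r (mod p^2), as a congruence of p-adic integers. -/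
open Finset

theorem PadicInt.eq_toZMod {p : ℕ} [Fact p.Prime] (f : ℤ_[p] →+* ZMod p) :
    f = PadicInt.toZMod := by
  ext x
  have h := PadicInt.sub_zmodRepr_mem x
  rw [PadicInt.maximalIdeal_eq_span_p, Ideal.mem_span_singleton] at h
  obtain ⟨c, hc⟩ := h
  rw [sub_eq_iff_eq_add] at hc
  rw [hc]
  simp

theorem PadicInt.toZMod_eq_zero_iff_dvd {p : ℕ} [Fact p.Prime] {x : ℤ_[p]} :
    PadicInt.toZMod x = 0 ↔ (p : ℤ_[p]) ∣ x := by
  rw [← RingHom.mem_ker, PadicInt.ker_toZMod, PadicInt.maximalIdeal_eq_span_p,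
    Ideal.mem_span_singleton]

/-- The Teichmüller character. -/
theorem exists_teichmuller_mulChar (p : ℕ) [Fact p.Prime] :
    ∃ ω : MulChar (ZMod p) ℤ_[p], ∀ x, PadicInt.toZMod (ω x) = x := by
  let e := WittVector.equiv p
  let t : ZMod p →* ℤ_[p] := (e : WittVector p (ZMod p) →* ℤ_[p]).comp (WittVector.teichmuller p)
  have ht : ∀ x, PadicInt.toZMod (t x) = x := fun x ↦ by
    rw [← PadicInt.eq_toZMod (WittVector.constantCoeff.comp e.symm.toRingHom)]
    simp [t, WittVector.constantCoeff_apply]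
  refine ⟨⟨t, fun a ha ↦ ?_⟩, ht⟩
  have : a = 0 := by simpa using ha
  subst this
  simp [t]

theorem neg_one_pow_mul_choose_eq {p : ℕ} [Fact p.Prime] {m n k : ℕ} (h : m + n + 1 = p)
    (hk : k ≤ n) : (-1) ^ k * (n.choose k : ZMod p) = ((m + k).choose k : ZMod p) := by
  induction k with
  | zero => simp
  | succ k ih =>
    have h0 : ((k + 1 : ℕ) : ZMod p) ≠ 0 := by
      rw [Ne, ZMod.natCast_eq_zero_iff]
      exact Nat.not_dvd_of_pos_of_lt k.succ_pos (by omega)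
    apply mul_right_cancel₀ h0
    have h1 : ((n.choose (k + 1) : ℕ) : ZMod p) * ((k + 1 : ℕ) : ZMod p)
        = n.choose k * ((n : ZMod p) - k) := by
      rw [← Nat.cast_sub (by omega), ← Nat.cast_mul, ← Nat.cast_mul, Nat.choose_succ_right_eq]
    have h2 : (((m + (k + 1)).choose (k + 1) : ℕ) : ZMod p) * ((k + 1 : ℕ) : ZMod p)
        = ((m : ZMod p) + k + 1) * (m + k).choose k := by
      rw [← Nat.cast_mul, ← add_assoc, ← Nat.add_one_mul_choose_eq]
      push_cast; ring
    have h3 : (m : ZMod p) + n + 1 = 0 := by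
      have : ((m + n + 1 : ℕ) : ZMod p) = 0 := by simp [h]
      simpa using this
    rw [mul_assoc, h1, h2, ← ih (by omega)]
    linear_combination (-1) ^ (k + 1) * (n.choose k : ZMod p) * h3

theorem sum_choose_div_add_one {K : Type*} [Field K] (n m : ℕ)
    (h : ∀ i < n, (i : K) + 1 ≠ 0) :
    ∑ i ∈ range n, ((n - 1 - i).choose m : K) / (i + 1) =
      n.choose m * (∑ i ∈ range n, ((i : K) + 1)⁻¹ - ∑ i ∈ range m, ((i : K) + 1)⁻¹) := by
  induction n generalizing m with
  | zero => cases m <;> simp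
  | succ n ih =>
    have ih := fun m ↦ ih m fun i hi ↦ h i (by omega)
    have hn := h n (by omega)
    cases m with
    | zero => simp [div_eq_inv_mul]
    | succ m =>
      have hP : ∀ i ∈ range n, ((n + 1 - 1 - i).choose (m + 1) : K) / (i + 1) =
          ((n - 1 - i).choose m : K) / (i + 1) + ((n - 1 - i).choose (m + 1) : K) / (i + 1) := by
        intro i hi
        rw [mem_range] at hi
        rw [show n + 1 - 1 - i = (n - 1 - i) + 1 by omega, Nat.choose_succ_succ]
        push_cast; ring
      rw [sum_range_succ, sum_congr rfl hP, sum_add_distrib, ih, ih, sum_range_succ _ m,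
        sum_range_succ _ n]
      have h1 : ((n : K) + 1) * n.choose m = (n + 1).choose (m + 1) * (m + 1) := by
        simpa using congrArg (Nat.cast (R := K)) (Nat.add_one_mul_choose_eq n m)
      by_cases hmn : m ≤ n
      · have hm := h m (by omega)
        have h2 : (n.choose m : K) / (m + 1) = (n + 1).choose (m + 1) / (n + 1) := by
          field_simp; linear_combination h1
        have h3 : ((n + 1).choose (m + 1) : K) = n.choose m + n.choose (m + 1) := by
          simpa using congrArg (Nat.cast (R := K)) (Nat.choose_succ_succ n m)
        simp only [div_eq_mul_inv] at h2 ⊢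
        simp only [add_tsub_cancel_right, Nat.sub_self, Nat.choose_zero_succ, Nat.cast_zero]
        linear_combination h2 - (∑ i ∈ range n, ((i : K) + 1)⁻¹ -
          ∑ i ∈ range m, ((i : K) + 1)⁻¹ - ((m : K) + 1)⁻¹) * h3
      · rw [Nat.choose_eq_zero_of_lt (by omega : n < m),
          Nat.choose_eq_zero_of_lt (by omega : n < m + 1),
          Nat.choose_eq_zero_of_lt (by omega : n + 1 < m + 1)]
        simp

theorem MulChar.pow_eq_one_iff_of_toZMod {p : ℕ} [Fact p.Prime] {ω : MulChar (ZMod p) ℤ_[p]}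
    (hω : ∀ x, PadicInt.toZMod (ω x) = x) {k : ℕ} : ω ^ k = 1 ↔ p - 1 ∣ k := by
  constructor
  · intro h1
    have := (FiniteField.forall_pow_eq_one_iff (ZMod p) k).1 fun u ↦ by
      have := congrArg (fun χ : MulChar (ZMod p) ℤ_[p] ↦ PadicInt.toZMod (χ u)) h1
      simp only [MulChar.pow_apply_coe, map_pow, hω, MulChar.one_apply_coe, map_one] at this
      ext; simpa using this
    rwa [ZMod.card] at this
  · rintro ⟨c, rfl⟩
    ext u
    rw [MulChar.pow_apply_coe, ← map_pow, ← Units.val_pow_eq_pow_val, pow_mul,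
      ZMod.units_pow_card_sub_one_eq_one]
    simp

theorem MulChar.sum_pow_of_toZMod {p : ℕ} [Fact p.Prime] {ω : MulChar (ZMod p) ℤ_[p]}
    (hω : ∀ x, PadicInt.toZMod (ω x) = x) {k : ℕ} (hk : k ≠ 0) :
    ∑ x, ω x ^ k = if p - 1 ∣ k then (p : ℤ_[p]) - 1 else 0 := by
  have hp1 : 1 ≤ p := (Fact.out : p.Prime).one_le
  simp_rw [← MulChar.pow_apply' ω hk]
  split_ifs with h
  · rw [(MulChar.pow_eq_one_iff_of_toZMod hω).2 h, MulChar.sum_one_eq_card_units, ZMod.card_units]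
    push_cast [hp1]; ring
  · exact MulChar.sum_eq_zero_of_ne_one fun h1 ↦ h ((MulChar.pow_eq_one_iff_of_toZMod hω).1 h1)

theorem ZMod.sum_pow {p : ℕ} [Fact p.Prime] {k : ℕ} (hk : k ≠ 0) :
    ∑ x : ZMod p, x ^ k = if p - 1 ∣ k then -1 else 0 := by
  obtain ⟨ω, hω⟩ := exists_teichmuller_mulChar p
  have := congrArg PadicInt.toZMod (MulChar.sum_pow_of_toZMod hω hk)
  simp only [map_sum, map_pow, hω] at this
  rw [this]
  split_ifs <;> simp


theorem one_sub_pow_eq_sum {R : Type*} [CommRing R] (x : R) (n : ℕ) :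
    (1 - x) ^ n = ∑ k ∈ range (n + 1), (-1) ^ k * (n.choose k : R) * x ^ k := by
  rw [sub_eq_neg_add, add_pow]
  refine sum_congr rfl fun k _ ↦ ?_
  rw [neg_pow]
  ring

theorem natCast_add_one_ne_zero {p : ℕ} [Fact p.Prime] {i : ℕ} (hi : i + 1 < p) :
    (i : ZMod p) + 1 ≠ 0 := by
  rw [← Nat.cast_add_one, Ne, ZMod.natCast_eq_zero_iff]
  exact Nat.not_dvd_of_pos_of_lt i.succ_pos hi

theorem sum_range_inv_eq {p f : ℕ} [Fact p.Prime] (hf : p = 3 * f + 1) (h2 : p ≠ 2) :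
    ∑ i ∈ range (2 * f), ((i : ZMod p) + 1)⁻¹ = ∑ i ∈ range f, ((i : ZMod p) + 1)⁻¹ := by
  rw [two_mul, sum_range_add, add_eq_left]
  have h : ∑ i ∈ range f, (((f + i : ℕ) : ZMod p) + 1)⁻¹
      = -∑ i ∈ range f, (((f + i : ℕ) : ZMod p) + 1)⁻¹ := by
    conv_lhs => rw [← sum_range_reflect]
    rw [← sum_neg_distrib]
    refine sum_congr rfl fun i hi ↦ ?_
    rw [mem_range] at hi
    have h1 : ((f + (f - 1 - i) + 1 + (f + i + 1) : ℕ) : ZMod p) = 0 := by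
      rw [show f + (f - 1 - i) + 1 + (f + i + 1) = p by omega]; simp
    rw [← inv_neg]
    congr 1
    push_cast at h1 ⊢
    linear_combination h1
  have h2' : (2 : ZMod p) ≠ 0 := by
    intro h
    have := (ZMod.natCast_eq_zero_iff 2 p).1 (by exact_mod_cast h)
    exact h2 ((Nat.prime_dvd_prime_iff_eq Fact.out Nat.prime_two).1 this)
  have : 2 * ∑ i ∈ range f, (((f + i : ℕ) : ZMod p) + 1)⁻¹ = 0 := by linear_combination h
  exact (mul_eq_zero.1 this).resolve_left h2'

theorem sum_choose_div_eq {p f : ℕ} [Fact p.Prime] (hf : p = 3 * f + 1) (hf0 : 2 ≤ f) :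
    4 * f * ∑ i ∈ range f, ((2 * f - i).choose (f + 1) : ZMod p) / (i + 1)
      = -(2 * f).choose f := by
  have h := sum_choose_div_add_one (K := ZMod p) (2 * f + 1) (f + 1)
    fun i hi ↦ natCast_add_one_ne_zero (by omega)
  rw [show 2 * f + 1 = f + (f + 1) by ring, sum_range_add, sum_eq_zero (s := range (f + 1)),
    add_zero, show f + (f + 1) = 2 * f + 1 by ring, sum_range_succ _ (2 * f), sum_range_succ _ f,
    sum_range_inv_eq hf (by omega), Nat.add_sub_cancel] at h
  · have hp : (3 * f + 1 : ZMod p) = 0 := by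
      have : ((3 * f + 1 : ℕ) : ZMod p) = 0 := by rw [← hf]; simp
      simpa using this
    have h1 : (f + 1 : ZMod p) ≠ 0 := natCast_add_one_ne_zero (by omega)
    have h2 : (2 * f + 1 : ZMod p) ≠ 0 := by
      simpa using natCast_add_one_ne_zero (i := 2 * f) (p := p) (by omega)
    have h3 : ((2 * f + 1 : ℕ) : ZMod p) * (2 * f).choose f
        = (2 * f + 1).choose (f + 1) * (f + 1) := by
      simpa using congrArg (Nat.cast (R := ZMod p)) (Nat.add_one_mul_choose_eq (2 * f) f)
    have h4 : ((2 * f + 1).choose (f + 1) : ZMod p) = (2 * f + 1) * (2 * f).choose f / (f + 1) := by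
      rw [eq_div_iff h1, ← h3]; push_cast; ring
    rw [h, h4]
    have h5 := inv_mul_cancel₀ h2
    have h6 := inv_mul_cancel₀ h1
    push_cast
    linear_combination 4 * f * ((2 * f).choose f : ZMod p) * (f + 1 : ZMod p)⁻¹ * h5 -
      (4 * f * (f + 1 : ZMod p)⁻¹ + ((f + 1 : ZMod p)⁻¹ * (f + 1) + 1)) *
        ((2 * f).choose f : ZMod p) * h6 +
      ((2 * f).choose f : ZMod p) * ((f + 1 : ZMod p)⁻¹) ^ 2 * (1 - f) * hp
  · intro i hi
    rw [Nat.choose_eq_zero_of_lt (by omega)]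
    simp

/-- The sum of `x ^ (2 * f) * (1 - x) ^ (2 * f - 1)` over `ZMod p`, weighted by the truncated
logarithm `∑ x ^ i / i`. -/
theorem sum_mul_truncated_log {p f : ℕ} [Fact p.Prime] (hf : p = 3 * f + 1) (hf0 : 2 ≤ f) :
    2 * f * ∑ x : ZMod p, x ^ (2 * f) * (1 - x) ^ (2 * f - 1) *
      ∑ i ∈ range (3 * f), x ^ (i + 1) / (i + 1) = (2 * f).choose f := by
  have hexp : ∑ x : ZMod p, x ^ (2 * f) * (1 - x) ^ (2 * f - 1) *
      ∑ i ∈ range (3 * f), x ^ (i + 1) / (i + 1) =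
      ∑ k ∈ range (2 * f), ∑ i ∈ range (3 * f), (-1) ^ k * ((2 * f - 1).choose k : ZMod p) / (i + 1)
        * ∑ x : ZMod p, x ^ (2 * f + k + (i + 1)) := by
    simp_rw [mul_sum _ _ (_ / _)]
    rw [sum_congr rfl fun k _ ↦ sum_comm, sum_comm]
    refine sum_congr rfl fun x _ ↦ ?_
    rw [one_sub_pow_eq_sum, Nat.sub_add_cancel (by omega), mul_assoc, sum_mul_sum, mul_sum]
    refine sum_congr rfl fun k _ ↦ ?_
    rw [mul_sum]
    refine sum_congr rfl fun i _ ↦ ?_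
    ring
  have hS : ∀ k ∈ range (2 * f), ∀ i ∈ range (3 * f),
      ∑ x : ZMod p, x ^ (2 * f + k + (i + 1)) =
        if i = (if k < f then f - 1 - k else 4 * f - 1 - k) then -1 else 0 := by
    intro k hk i hi
    rw [mem_range] at hk hi
    rw [ZMod.sum_pow (by omega)]
    congr 1
    rw [eq_iff_iff, hf, Nat.add_sub_cancel]
    constructor
    · rintro ⟨c, hc⟩
      obtain hc0 | rfl | rfl | hc0 : c = 0 ∨ c = 1 ∨ c = 2 ∨ 3 ≤ c := by omega
      · subst hc0; omega
      · split_ifs <;> omega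
      · split_ifs <;> omega
      · have := Nat.mul_le_mul_left (3 * f) hc0
        omega
    · intro h
      split_ifs at h
      · exact ⟨1, by omega⟩
      · exact ⟨2, by omega⟩
  have hsum : ∑ x : ZMod p, x ^ (2 * f) * (1 - x) ^ (2 * f - 1) *
      ∑ i ∈ range (3 * f), x ^ (i + 1) / (i + 1) =
      -(2 * ∑ i ∈ range f, ((2 * f - i).choose (f + 1) : ZMod p) / (i + 1)) := by
    rw [hexp]
    have : ∀ k ∈ range (2 * f), ∑ i ∈ range (3 * f),
        (-1) ^ k * ((2 * f - 1).choose k : ZMod p) / (i + 1)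
          * ∑ x : ZMod p, x ^ (2 * f + k + (i + 1)) =
        -((-1) ^ k * ((2 * f - 1).choose k : ZMod p) /
          ((if k < f then f - 1 - k else 4 * f - 1 - k : ℕ) + 1)) := by
      intro k hk
      rw [sum_congr rfl fun i hi ↦ by rw [hS k hk i hi]]
      rw [mem_range] at hk
      simp only [mul_ite, mul_neg, mul_one, mul_zero]
      rw [sum_ite_eq', if_pos]
      rw [mem_range]
      split_ifs <;> omega
    rw [sum_congr rfl this, two_mul f, sum_range_add, ← sum_range_reflect _ f, two_mul, neg_add,
      ← sum_neg_distrib]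
    congr 1
    · refine sum_congr rfl fun j hj ↦ ?_
      rw [mem_range] at hj
      rw [neg_one_pow_mul_choose_eq (m := f + 1) (by omega) (by omega), if_pos (by omega),
        show f - 1 - (f - 1 - j) = j by omega,
        ← Nat.choose_symm (by omega : f - 1 - j ≤ f + 1 + (f - 1 - j))]
      congr 4 <;> omega
    · refine sum_congr rfl fun j hj ↦ ?_
      rw [mem_range] at hj
      have h1 : (-1 : ZMod p) ^ (f + j) = -(-1) ^ (f - 1 - j) := by
        rw [show f + j = (f - 1 - j) + (2 * j + 1) by omega, pow_add, pow_succ, pow_mul]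
        simp
      rw [if_neg (by omega), h1, ← Nat.choose_symm (by omega : f + j ≤ f + f - 1),
        show f + f - 1 - (f + j) = f - 1 - j by omega, neg_mul,
        neg_one_pow_mul_choose_eq (m := f + 1) (by omega) (by omega),
        ← Nat.choose_symm (by omega : f - 1 - j ≤ f + 1 + (f - 1 - j)),
        show f + 1 + (f - 1 - j) - (f - 1 - j) = f + 1 by omega,
        show f + 1 + (f - 1 - j) = f + f - j by omega]
      have h2 : ((4 * f - 1 - (f + j) : ℕ) : ZMod p) + 1 = -((j : ZMod p) + 1) := by
        have : ((4 * f - 1 - (f + j) + 1 + (j + 1) : ℕ) : ZMod p) = 0 := by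
          rw [show 4 * f - 1 - (f + j) + 1 + (j + 1) = p by omega]; simp
        push_cast at this
        linear_combination this
      rw [h2, neg_div_neg_eq]
  rw [hsum, ← neg_neg ((2 * f).choose f : ZMod p), ← sum_choose_div_eq hf hf0]
  ring

theorem neg_one_pow_mul_choose_div_prime {p : ℕ} [Fact p.Prime] {i : ℕ} (hi : i + 1 < p) :
    (-1) ^ (i + 1) * ((p.choose (i + 1) / p : ℕ) : ZMod p) = -((i : ZMod p) + 1)⁻¹ := by
  have hp : p.Prime := Fact.out
  have h1 : p.choose (i + 1) / p * (i + 1) = (p - 1).choose i := by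
    obtain ⟨c, hc⟩ := hp.dvd_choose_self i.succ_ne_zero hi
    have h := Nat.add_one_mul_choose_eq (p - 1) i
    rw [Nat.sub_add_cancel hp.one_le, hc, mul_assoc] at h
    rw [hc, Nat.mul_div_cancel_left _ hp.pos, Nat.eq_of_mul_eq_mul_left hp.pos h]
  have h2 := neg_one_pow_mul_choose_eq (p := p) (m := 0) (n := p - 1) (k := i) (by omega) (by omega)
  rw [← h1] at h2
  push_cast at h2
  rw [zero_add, Nat.choose_self, Nat.cast_one] at h2
  rw [← mul_inv_cancel_right₀ (natCast_add_one_ne_zero hi) ((-1) ^ (i + 1) * _)]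
  linear_combination -((i : ZMod p) + 1)⁻¹ * h2

theorem sum_pow_mul_one_sub_pow {p f : ℕ} [Fact p.Prime] (hf : p = 3 * f + 1) (hf0 : 2 ≤ f)
    (hf2 : Even f) {ω : MulChar (ZMod p) ℤ_[p]} (hω : ∀ x, PadicInt.toZMod (ω x) = x) :
    ∑ x, ω x ^ (2 * f) * (1 - ω x) ^ (2 * f) = (p - 1) * (2 * f).choose f := by
  simp_rw [one_sub_pow_eq_sum, mul_sum]
  rw [sum_comm]
  have h : ∀ k ∈ range (2 * f + 1),
      ∑ x, ω x ^ (2 * f) * ((-1) ^ k * ((2 * f).choose k : ℤ_[p]) * ω x ^ k) =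
        if k = f then ((p : ℤ_[p]) - 1) * (2 * f).choose f else 0 := by
    intro k hk
    rw [mem_range] at hk
    have hd : p - 1 ∣ 2 * f + k ↔ k = f := by
      rw [hf, Nat.add_sub_cancel]
      constructor
      · rintro ⟨c, hc⟩
        obtain hc0 | rfl | hc0 : c = 0 ∨ c = 1 ∨ 2 ≤ c := by omega
        · subst hc0; omega
        · omega
        · have := Nat.mul_le_mul_left (3 * f) hc0
          omega
      · rintro rfl
        exact ⟨1, by ring⟩
    have hs := MulChar.sum_pow_of_toZMod hω (k := 2 * f + k) (by omega)
    simp_rw [hd] at hs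
    calc _ = (-1) ^ k * ((2 * f).choose k : ℤ_[p]) * ∑ x, ω x ^ (2 * f + k) := by
          rw [mul_sum]
          exact sum_congr rfl fun x _ ↦ by ring
      _ = _ := by
          rw [hs]
          split_ifs with hkf
          · subst hkf
            rw [hf2.neg_one_pow]; ring
          · simp
  rw [sum_congr rfl h, sum_ite_eq', if_pos (by simp; omega)]

/-- If `ω` is the Teichmüller character and `p = 3 f + 1`, then
`J(ω ^ (2 f), ω ^ (2 f)) ≡ -C(2 f, f) (mod p ^ 2)`. -/
theorem sq_dvd_jacobiSum_add_choose {p f : ℕ} [Fact p.Prime] (hf : p = 3 * f + 1) (hf0 : 2 ≤ f)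
    (hf2 : Even f) {ω : MulChar (ZMod p) ℤ_[p]} (hω : ∀ x, PadicInt.toZMod (ω x) = x) :
    (p : ℤ_[p]) ^ 2 ∣ jacobiSum (ω ^ (2 * f)) (ω ^ (2 * f)) + (2 * f).choose f := by
  have hp : p.Prime := Fact.out
  have hωp : ∀ x, ω x ^ p = ω x := fun x ↦ by rw [← map_pow, ZMod.pow_card]
  let g : ℤ_[p] → ℤ_[p] := fun w ↦
    ∑ i ∈ range (3 * f), (-1) ^ (i + 1) * ((p.choose (i + 1) / p : ℕ) : ℤ_[p]) * w ^ (i + 1)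
  have hg : ∀ x, (1 - ω x) ^ p = 1 - ω x + p * g (ω x) := by
    intro x
    have hodd : Odd p := by rw [hf]; exact (hf2.mul_left 3).add_one
    rw [one_sub_pow_eq_sum, sum_range_succ, hodd.neg_one_pow, hωp, Nat.choose_self,
      show range p = range (3 * f + 1) by rw [← hf], sum_range_succ', mul_sum]
    have : ∀ i ∈ range (3 * f), (-1) ^ (i + 1) * (p.choose (i + 1) : ℤ_[p]) * ω x ^ (i + 1) =
        p * ((-1) ^ (i + 1) * ((p.choose (i + 1) / p : ℕ) : ℤ_[p]) * ω x ^ (i + 1)) := by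
      intro i hi
      rw [mem_range] at hi
      obtain ⟨c, hc⟩ := hp.dvd_choose_self i.succ_ne_zero (by omega)
      rw [hc, Nat.mul_div_cancel_left _ hp.pos]
      push_cast; ring
    rw [sum_congr rfl this]
    simp; ring
  have hgmod : ∀ x, PadicInt.toZMod (g (ω x)) = -∑ i ∈ range (3 * f), x ^ (i + 1) / (i + 1) := by
    intro x
    rw [← sum_neg_distrib, map_sum]
    refine sum_congr rfl fun i hi ↦ ?_
    rw [mem_range] at hi
    simp only [map_mul, map_pow, map_neg, map_one, map_natCast, hω]
    rw [neg_one_pow_mul_choose_div_prime (by omega)]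
    ring
  have hterm : ∀ x, (p : ℤ_[p]) ^ 2 ∣ (ω ^ (2 * f)) x * (ω ^ (2 * f)) (1 - x) -
      (ω x ^ (2 * f) * (1 - ω x) ^ (2 * f) +
        p * (2 * f * (ω x ^ (2 * f) * (1 - ω x) ^ (2 * f - 1) * g (ω x)))) := by
    intro x
    have h1 : (p : ℤ_[p]) ∣ ω (1 - x) - (1 - ω x) := by
      rw [← PadicInt.toZMod_eq_zero_iff_dvd]
      simp [hω]
    have h2 := dvd_sub_pow_of_dvd_sub h1 1
    rw [pow_one, hωp, hg] at h2
    have h3 := h2.trans (sub_dvd_pow_sub_pow _ _ (2 * f))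
    obtain ⟨c, hc⟩ := Polynomial.powAddExpansion (1 - ω x) (p * g (ω x)) (2 * f)
    obtain ⟨d, hd⟩ := h3
    rw [hc] at hd
    rw [MulChar.pow_apply' _ (by omega), MulChar.pow_apply' _ (by omega)]
    refine ⟨ω x ^ (2 * f) * (d + c * g (ω x) ^ 2), ?_⟩
    push_cast at hd
    linear_combination ω x ^ (2 * f) * hd
  have hlin : (p : ℤ_[p]) ∣ (2 * f).choose f +
      2 * f * ∑ x, ω x ^ (2 * f) * (1 - ω x) ^ (2 * f - 1) * g (ω x) := by
    rw [← PadicInt.toZMod_eq_zero_iff_dvd]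
    have h := sum_mul_truncated_log hf hf0
    simp only [map_add, map_mul, map_sum, map_pow, map_sub, map_one, map_natCast, hω, hgmod,
      map_ofNat]
    simp only [mul_neg, sum_neg_distrib]
    rw [h]
    ring
  obtain ⟨c, hc⟩ := hlin
  obtain ⟨d, hd⟩ := dvd_sum fun x (_ : x ∈ (univ : Finset (ZMod p))) ↦ hterm x
  rw [sum_sub_distrib, sum_add_distrib, sum_pow_mul_one_sub_pow hf hf0 hf2 hω, ← mul_sum,
    ← mul_sum] at hd
  refine ⟨c + d, ?_⟩
  rw [jacobiSum]
  linear_combination hd + p * hc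

/-- The representation `4 p = r ^ 2 + 27 s ^ 2` with `r ≡ 1 (mod 3)` determines `r`. -/
theorem eq_of_four_mul_prime_eq {p : ℕ} (hp : p.Prime) {r s a b : ℤ}
    (hrs : 4 * (p : ℤ) = r ^ 2 + 27 * s ^ 2) (hab : 4 * (p : ℤ) = a ^ 2 + 27 * b ^ 2)
    (hr : r ≡ 1 [ZMOD 3]) (ha : a ≡ 1 [ZMOD 3]) : r = a := by
  have hp0 : (p : ℤ) ≠ 0 := by exact_mod_cast hp.ne_zero
  have key : ∀ b : ℤ, 4 * (p : ℤ) = a ^ 2 + 27 * b ^ 2 → (p : ℤ) ∣ a * s - r * b →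
      r ^ 2 = a ^ 2 := by
    rintro b hab ⟨k, hk⟩
    have h1 : (a * r + 27 * s * b) ^ 2 + 27 * (a * s - r * b) ^ 2 = 16 * (p : ℤ) ^ 2 := by
      linear_combination (-(4 * (p : ℤ))) * hrs - (r ^ 2 + 27 * s ^ 2) * hab
    have hk0 : k = 0 := by
      by_contra hk0
      have : 1 ≤ k ^ 2 := by have := sq_pos_of_ne_zero hk0; omega
      have hpp : 0 < (p : ℤ) ^ 2 := by positivity
      rw [hk] at h1
      nlinarith [sq_nonneg (a * r + 27 * s * b)]
    rw [hk0, mul_zero, sub_eq_zero] at hk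
    have h2 : 4 * (p : ℤ) * (s ^ 2 - b ^ 2) = 0 := by
      linear_combination (a * s + r * b) * hk + s ^ 2 * hab - b ^ 2 * hrs
    have h3 : s ^ 2 - b ^ 2 = 0 := (mul_eq_zero.1 h2).resolve_left (by positivity)
    linear_combination hab - hrs - 27 * h3
  have hd : (p : ℤ) ∣ (a * s - r * b) * (a * s - r * -b) :=
    ⟨4 * (s ^ 2 - b ^ 2), by linear_combination b ^ 2 * hrs - s ^ 2 * hab⟩
  have hsq : r ^ 2 = a ^ 2 := by
    rcases (Nat.prime_iff_prime_int.1 hp).dvd_or_dvd hd with h | h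
    · exact key b hab h
    · exact key (-b) (by rw [neg_sq]; exact hab) h
  rcases sq_eq_sq_iff_eq_or_eq_neg.1 hsq with h | h
  · exact h
  · rw [Int.ModEq] at hr ha
    omega

section cubic

variable {R : Type*} [CommRing R] [IsDomain R] {μ : R}

theorem IsPrimitiveRoot.sq_add_self_add_one (hμ : IsPrimitiveRoot μ 3) : μ ^ 2 + μ + 1 = 0 := by
  have := hμ.geom_sum_eq_zero (by norm_num)
  simp only [sum_range_succ, sum_range_zero] at this
  linear_combination this

theorem IsPrimitiveRoot.exists_eq_of_mem_adjoin (hμ : IsPrimitiveRoot μ 3) {z : R}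
    (hz : z ∈ Algebra.adjoin ℤ {μ}) : ∃ c d : ℤ, z = c + d * μ := by
  have h := hμ.sq_add_self_add_one
  induction hz using Algebra.adjoin_induction with
  | mem x hx => exact ⟨0, 1, by simpa using hx⟩
  | algebraMap n => exact ⟨n, 0, by simp⟩
  | add x y _ _ hx hy =>
    obtain ⟨c, d, rfl⟩ := hx
    obtain ⟨c', d', rfl⟩ := hy
    exact ⟨c + c', d + d', by push_cast; ring⟩
  | mul x y _ _ hx hy =>
    obtain ⟨c, d, rfl⟩ := hx
    obtain ⟨c', d', rfl⟩ := hy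
    exact ⟨c * c' - d * d', c * d' + c' * d - d * d', by
      push_cast; linear_combination (d : R) * d' * h⟩

theorem IsPrimitiveRoot.intCast_add_mul_injective [CharZero R] (hμ : IsPrimitiveRoot μ 3)
    {a b c d : ℤ} (h : (a + b * μ : R) = c + d * μ) : a = c ∧ b = d := by
  have h1 := hμ.sq_add_self_add_one
  have h2 : (((a - c) ^ 2 - (a - c) * (b - d) + (b - d) ^ 2 : ℤ) : R) = 0 := by
    push_cast
    linear_combination ((a : R) - c - (b - d) - (b - d) * μ) * h + ((b : R) - d) ^ 2 * h1
  have h3 : (a - c) ^ 2 - (a - c) * (b - d) + (b - d) ^ 2 = 0 := by exact_mod_cast h2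
  have hb : (b - d) ^ 2 = 0 := by nlinarith [sq_nonneg (2 * (a - c) - (b - d)), sq_nonneg (b - d)]
  have ha : (a - c) ^ 2 = 0 := by nlinarith [sq_nonneg (2 * (b - d) - (a - c)), sq_nonneg (a - c)]
  exact ⟨sub_eq_zero.1 (pow_eq_zero_iff two_ne_zero |>.1 ha),
    sub_eq_zero.1 (pow_eq_zero_iff two_ne_zero |>.1 hb)⟩

variable {F : Type*} [Field F] [Fintype F]

theorem exists_jacobiSum_and_jacobiSum_inv_eq (hμ : IsPrimitiveRoot μ 3) {χ : MulChar F R}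
    (hχ : χ ^ 3 = 1) : ∃ a b : ℤ, jacobiSum χ χ = a + b * μ ∧
      jacobiSum χ⁻¹ χ⁻¹ = a + b * μ ^ 2 := by
  have h1 := hμ.sq_add_self_add_one
  have hinv : χ⁻¹ = χ ^ 2 := inv_eq_of_mul_eq_one_right (by rw [← pow_succ']; exact hχ)
  have h : ∀ y : F, ∃ a b : ℤ, χ y = a + b * μ ∧ χ⁻¹ y = a + b * μ ^ 2 := by
    intro y
    by_cases hy : y = 0
    · subst hy
      exact ⟨0, 0, by simp [MulChar.map_zero]⟩
    rw [hinv, MulChar.pow_apply' _ two_ne_zero]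
    obtain ⟨k, hk, hky⟩ := MulChar.exists_apply_eq_pow hχ hμ hy
    rw [hky]
    interval_cases k
    · exact ⟨1, 0, by simp, by simp⟩
    · exact ⟨0, 1, by simp, by simp⟩
    · refine ⟨-1, -1, ?_, ?_⟩ <;> push_cast
      · linear_combination h1
      · linear_combination (μ ^ 2 - μ + 1) * h1
  choose a b ha hb using h
  refine ⟨∑ x, a (x * (1 - x)), ∑ x, b (x * (1 - x)), ?_, ?_⟩ <;> rw [jacobiSum] <;> push_cast <;>
    rw [sum_mul, ← sum_add_distrib] <;> refine sum_congr rfl fun x _ ↦ ?_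
  · rw [← map_mul, ha]
  · rw [← map_mul, hb]

theorem exists_jacobiSum_cubic_eq [CharZero R] (hF : 3 ∣ Fintype.card F - 1)
    (hμ : IsPrimitiveRoot μ 3) {χ : MulChar F R} (hχ : χ ^ 3 = 1) :
    ∃ a b : ℤ, a ≡ 2 [ZMOD 3] ∧ jacobiSum χ χ = a + (3 * b) * μ ∧
      jacobiSum χ⁻¹ χ⁻¹ = a + (3 * b) * μ ^ 2 := by
  have h1 := hμ.sq_add_self_add_one
  obtain ⟨a, b, ha, hb⟩ := exists_jacobiSum_and_jacobiSum_inv_eq hμ hχ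
  obtain ⟨z, hz, hJ⟩ := exists_jacobiSum_eq_neg_one_add (by norm_num) hχ hχ hF hμ
  obtain ⟨c, d, rfl⟩ := hμ.exists_eq_of_mem_adjoin hz
  obtain ⟨rfl, rfl⟩ := hμ.intCast_add_mul_injective (a := a) (b := b) (c := 3 * d - 1)
    (d := 3 * (d - c)) (by
      rw [← ha, hJ]; push_cast
      linear_combination (c + d * μ - 3 * d) * h1)
  refine ⟨3 * d - 1, d - c, ?_, by rw [ha]; push_cast; ring, by rw [hb]; push_cast; ring⟩
  rw [Int.ModEq]
  omega

end cubic

theorem PadicInt.jacobiSum_mul_jacobiSum_inv {p : ℕ} [Fact p.Prime]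
    {χ φ : MulChar (ZMod p) ℤ_[p]} (hχ : χ ≠ 1) (hφ : φ ≠ 1) (hχφ : χ * φ ≠ 1) :
    jacobiSum χ φ * jacobiSum χ⁻¹ φ⁻¹ = p := by
  let c := algebraMap ℤ_[p] ℚ_[p]
  have hinj : Function.Injective c := FaithfulSMul.algebraMap_injective _ _
  apply hinj
  have h0 : ringChar ℚ_[p] ≠ ringChar (ZMod p) := by
    rw [ringChar.eq_zero, ZMod.ringChar_zmod_n]
    exact (Fact.out : p.Prime).ne_zero.symm
  have h := _root_.jacobiSum_mul_jacobiSum_inv h0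
    ((MulChar.ringHomComp_ne_one_iff hinj).2 hχ) ((MulChar.ringHomComp_ne_one_iff hinj).2 hφ)
    (by rw [← MulChar.ringHomComp_mul]; exact (MulChar.ringHomComp_ne_one_iff hinj).2 hχφ)
  rw [MulChar.ringHomComp_inv, MulChar.ringHomComp_inv, jacobiSum_ringHomComp,
    jacobiSum_ringHomComp, ZMod.card] at h
  rw [map_mul, h, map_natCast]

/-- Evans–Yeung: for a prime `p ≡ 1 (mod 6)` with `4p = r² + 27s²`, `r ≡ 1 (mod 3)`,
`C(2(p-1)/3, (p-1)/3) ≡ -r + p/r (mod p²)` in `ℤ_p`. -/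
theorem evans_yeung_congruence (p : ℕ) [hp : Fact p.Prime] (hp6 : p % 6 = 1)
    (r s : ℤ) (hrs : 4 * (p : ℤ) = r ^ 2 + 27 * s ^ 2) (hr : r ≡ 1 [ZMOD 3]) :
    ∃ z : ℤ_[p],
      (Nat.choose (2 * (p - 1) / 3) ((p - 1) / 3) : ℚ_[p]) -
        (-(r : ℚ_[p]) + (p : ℚ_[p]) / (r : ℚ_[p]))
      = (p : ℚ_[p]) ^ 2 * (z : ℚ_[p]) := by
  have hp1 := hp.out.one_lt
  obtain ⟨f, hf⟩ : ∃ f, p = 3 * f + 1 := ⟨(p - 1) / 3, by omega⟩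
  have hf2 : Even f := by rw [Nat.even_iff]; omega
  have hf0 : 2 ≤ f := by have := Nat.even_iff.1 hf2; omega
  rw [show 2 * (p - 1) / 3 = 2 * f by omega, show (p - 1) / 3 = f by omega]
  obtain ⟨ω, hω⟩ := exists_teichmuller_mulChar p
  obtain ⟨c, hc⟩ := sq_dvd_jacobiSum_add_choose hf hf0 hf2 hω
  set χ := ω ^ (2 * f) with hχdef
  have hne : ∀ k, 0 < k → k < 3 → ω ^ (2 * f * k) ≠ 1 := by
    intro k hk0 hk3
    rw [Ne, MulChar.pow_eq_one_iff_of_toZMod hω, hf, Nat.add_sub_cancel,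
      show 2 * f * k = f * (2 * k) by ring, mul_comm 3 f, Nat.mul_dvd_mul_iff_left (by omega)]
    omega
  have hχ3 : χ ^ 3 = 1 := by
    rw [hχdef, ← pow_mul, MulChar.pow_eq_one_iff_of_toZMod hω, hf, Nat.add_sub_cancel]
    exact ⟨2, by ring⟩
  have hχ1 : χ ≠ 1 := by simpa using hne 1 (by norm_num) (by norm_num)
  have hχ2 : χ * χ ≠ 1 := by
    rw [← sq, hχdef, ← pow_mul]
    exact hne 2 (by norm_num) (by norm_num)
  obtain ⟨u, hu⟩ := MulChar.ne_one_iff.1 hχ1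
  have hμ : IsPrimitiveRoot (χ u) 3 := by
    have := orderOf_eq_prime (x := χ u) (p := 3)
      (by rw [← MulChar.pow_apply_coe, hχ3, MulChar.one_apply_coe]) hu
    exact this ▸ IsPrimitiveRoot.orderOf (χ u)
  obtain ⟨a, b, ha, hJ, hJ'⟩ := exists_jacobiSum_cubic_eq
    (by rw [ZMod.card, hf, Nat.add_sub_cancel]; exact ⟨f, rfl⟩) hμ hχ3
  have hμ1 := hμ.sq_add_self_add_one
  have hprod := PadicInt.jacobiSum_mul_jacobiSum_inv hχ1 hχ1 hχ2
  set J := jacobiSum χ χ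
  set J' := jacobiSum χ⁻¹ χ⁻¹
  set μ := χ u
  have hnorm : (p : ℤ) = a ^ 2 - a * (3 * b) + (3 * b) ^ 2 := by
    have : ((p : ℤ) : ℤ_[p]) = (a ^ 2 - a * (3 * b) + (3 * b) ^ 2 : ℤ) := by
      push_cast
      rw [← hprod, hJ, hJ']
      linear_combination (3 * a * b + 9 * b ^ 2 * (μ - 1)) * hμ1
    exact_mod_cast this
  have hra : r = 2 * a - 3 * b := by
    refine eq_of_four_mul_prime_eq hp.out hrs (b := b) (by rw [hnorm]; ring) hr ?_
    rw [Int.ModEq] at ha ⊢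
    omega
  have htr : (r : ℤ_[p]) = J + J' := by
    rw [hra, hJ, hJ']
    push_cast
    linear_combination -(3 * b : ℤ_[p]) * hμ1
  have hnd : ¬ (p : ℤ_[p]) ∣ J := by
    intro h
    have h2 : (p : ℤ_[p]) ∣ ((2 * f).choose f : ℕ) := by
      have := (dvd_mul_of_dvd_left (dvd_pow_self (p : ℤ_[p]) two_ne_zero) c).sub h
      rw [← hc] at this
      simpa using this
    rw [← PadicInt.toZMod_eq_zero_iff_dvd, map_natCast, ZMod.natCast_eq_zero_iff] at h2
    have h3 : p ∣ Nat.factorial (2 * f) := h2.trans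
      ⟨_, by rw [← mul_assoc, Nat.choose_mul_factorial_mul_factorial (by omega : f ≤ 2 * f)]⟩
    have := hp.out.dvd_factorial.1 h3
    omega
  have hunit : ∀ x : ℤ_[p], ¬ (p : ℤ_[p]) ∣ x → IsUnit x := fun x hx ↦ by
    rwa [← PadicInt.norm_lt_one_iff_dvd, ← PadicInt.not_isUnit_iff, not_not] at hx
  obtain ⟨v, hv⟩ := (hunit J hnd).exists_left_inv
  have hJv : J' = p * v := by linear_combination v * hprod - J' * hv
  have hru : IsUnit (r : ℤ_[p]) := hunit _ fun h ↦ hnd <| by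
    rw [htr, hJv] at h
    exact (dvd_add_left (dvd_mul_right _ _)).1 h
  obtain ⟨w, hw⟩ := hru.exists_left_inv
  refine ⟨c + w * v ^ 2, ?_⟩
  have hwq : (r : ℚ_[p])⁻¹ = (w : ℚ_[p]) := by
    refine inv_eq_of_mul_eq_one_left ?_
    have := congrArg (fun x : ℤ_[p] ↦ (x : ℚ_[p])) hw
    simpa using this
  rw [div_eq_mul_inv, hwq]
  have key : ((2 * f).choose f : ℤ_[p]) - (-r + p * w) = p ^ 2 * (c + w * v ^ 2) := by
    linear_combination hc + (1 + p * v * w) * htr + (1 + p * v * w) * hJv - p * v * hw + p * w * hv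
  have := congrArg (fun x : ℤ_[p] ↦ (x : ℚ_[p])) key
  simpa using this
end
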